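/- arXiv:2507.00901 — 10 statements merged into one kernel-verified Lean document; each statement's English description precedes it below -/
import Mathlib

section
/- Let 𝔳 = (V_i, v_i, v^i) be a linked chain over a field k and let i < j be integers. Then ker(v^i_j : V_i → V_j) = ker(v^i : V_i → V_{i+1}) and ker(v^j_i : V_j → V_i) = ker(v_{j-1} : V_j → V_{j-1}); that is, the kernel of a composition of transfer maps equals the kernel of the first map applied. -/
open LinearMap Submodule Module

namespace ZChain

universe u v

variable {k : Type u} [Field k]

/-- Cast between the spaces of a representation along an equality of indices. -/
def castMap {V : ℤ → Type v} [∀ i, AddCommGroup (V i)] [∀ i, Module k (V i)]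
    {i j : ℤ} (h : i = j) : V i →ₗ[k] V j := by subst h; exact LinearMap.id

variable {V : ℤ → Type v} [∀ i, AddCommGroup (V i)] [∀ i, Module k (V i)]

/-- Iterated upward maps `v^{i+n-1} ∘ ⋯ ∘ v^i : V i → V (i+n)`. -/
def upPow (up : ∀ i : ℤ, V i →ₗ[k] V (i + 1)) : ∀ (n : ℕ) (i : ℤ), V i →ₗ[k] V (i + n)
  | 0, _ => castMap (by simp)
  | n + 1, i => castMap (by push_cast; ring) ∘ₗ up (i + n) ∘ₗ upPow up n i

/-- Iterated downward maps `v_i ∘ ⋯ ∘ v_{i+n-1} : V (i+n) → V i`. -/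
def downPow (down : ∀ i : ℤ, V (i + 1) →ₗ[k] V i) : ∀ (n : ℕ) (i : ℤ), V (i + n) →ₗ[k] V i
  | 0, _ => castMap (by simp)
  | n + 1, i => downPow down n i ∘ₗ down (i + n) ∘ₗ castMap (by push_cast; ring)

/-- The transfer map `v^i_j : V i → V j`: the identity if `i = j`, the composition of the
upward maps if `i < j`, and the composition of the downward maps if `i > j`. -/
def transfer (up : ∀ i : ℤ, V i →ₗ[k] V (i + 1)) (down : ∀ i : ℤ, V (i + 1) →ₗ[k] V i)
    (i j : ℤ) : V i →ₗ[k] V j :=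
  if h : i ≤ j then castMap (by omega) ∘ₗ upPow up (j - i).toNat i
  else downPow down (i - j).toNat j ∘ₗ castMap (by omega)

/-- A special chain: opposite arrows compose to zero. -/
def SpecialChain (up : ∀ i : ℤ, V i →ₗ[k] V (i + 1))
    (down : ∀ i : ℤ, V (i + 1) →ₗ[k] V i) : Prop :=
  ∀ i : ℤ, down i ∘ₗ up i = 0 ∧ up i ∘ₗ down i = 0

/-- A linked chain: a special chain such that the kernels of the two maps leaving any
vertex intersect trivially. -/
def LinkedChain (up : ∀ i : ℤ, V i →ₗ[k] V (i + 1))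
    (down : ∀ i : ℤ, V (i + 1) →ₗ[k] V i) : Prop :=
  SpecialChain up down ∧ ∀ i : ℤ, ker (down i) ⊓ ker (up (i + 1)) = ⊥

/-- A colinked chain: a special chain such that the images of the two maps arriving at any
vertex sum up to everything. -/
def ColinkedChain (up : ∀ i : ℤ, V i →ₗ[k] V (i + 1))
    (down : ∀ i : ℤ, V (i + 1) →ₗ[k] V i) : Prop :=
  SpecialChain up down ∧ ∀ i : ℤ, range (down (i + 1)) ⊔ range (up i) = ⊤

/-- An exact representation: the kernel of each arrow is the image of the opposite arrow. -/
def ExactRep (up : ∀ i : ℤ, V i →ₗ[k] V (i + 1))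
    (down : ∀ i : ℤ, V (i + 1) →ₗ[k] V i) : Prop :=
  ∀ i : ℤ, ker (up i) = range (down i) ∧ ker (down i) = range (up i)

/-- `H` is a support: for each vertex `i` some transfer map `v^j_i` with `j ∈ H` is surjective. -/
def RepSupport (up : ∀ i : ℤ, V i →ₗ[k] V (i + 1))
    (down : ∀ i : ℤ, V (i + 1) →ₗ[k] V i) (H : Set ℤ) : Prop :=
  ∀ i : ℤ, ∃ j ∈ H, Function.Surjective (transfer up down j i)

/-- `H` is a cosupport: for each vertex `i` some transfer map `v^i_j` with `j ∈ H` is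
injective. -/
def RepCosupport (up : ∀ i : ℤ, V i →ₗ[k] V (i + 1))
    (down : ∀ i : ℤ, V (i + 1) →ₗ[k] V i) (H : Set ℤ) : Prop :=
  ∀ i : ℤ, ∃ j ∈ H, Function.Injective (transfer up down i j)

/-- A subrepresentation: a family of subspaces preserved by all the maps. -/
def IsSubrep (up : ∀ i : ℤ, V i →ₗ[k] V (i + 1))
    (down : ∀ i : ℤ, V (i + 1) →ₗ[k] V i) (W : ∀ i : ℤ, Submodule k (V i)) : Prop :=
  ∀ i : ℤ, (∀ x ∈ W i, up i x ∈ W (i + 1)) ∧ (∀ x ∈ W (i + 1), down i x ∈ W i)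


theorem castMap_eq_zero_iff {i j : ℤ} (h : i = j) (x : V i) :
    castMap (k := k) h x = 0 ↔ x = 0 := by
  subst h; rfl

theorem up_castMap_eq_zero_iff (up : ∀ i : ℤ, V i →ₗ[k] V (i + 1)) {i j : ℤ} (h : i = j)
    (x : V i) : up j (castMap (k := k) h x) = 0 ↔ up i x = 0 := by
  subst h; rfl

theorem down_castMap_castMap_eq_zero_iff (down : ∀ i : ℤ, V (i + 1) →ₗ[k] V i) {a b c : ℤ}
    (h : a = b) (h' : b = c + 1) (x : V a) :
    down c (castMap (k := k) h' (castMap (k := k) h x)) = 0 ↔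
      down c (castMap (k := k) (h.trans h') x) = 0 := by
  subst h; rfl

section LinkedChain

variable {up : ∀ i : ℤ, V i →ₗ[k] V (i + 1)} {down : ∀ i : ℤ, V (i + 1) →ₗ[k] V i}

theorem LinkedChain.eq_zero_of_up_up (hlc : LinkedChain up down) {a b : ℤ} (h : a + 1 = b)
    (x : V a) (hx : up b (castMap (k := k) h (up a x)) = 0) : up a x = 0 := by
  subst h
  have hmem : up a x ∈ ker (down a) ⊓ ker (up (a + 1)) :=
    ⟨LinearMap.congr_fun (hlc.1 a).1 x, hx⟩
  rwa [hlc.2 a, Submodule.mem_bot] at hmem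

theorem LinkedChain.eq_zero_of_down_down (hlc : LinkedChain up down) {a b : ℤ} (h : b = a + 1)
    (x : V (b + 1)) (hx : down a (castMap (k := k) h (down b x)) = 0) : down b x = 0 := by
  subst h
  have hmem : down (a + 1) x ∈ ker (down a) ⊓ ker (up (a + 1)) :=
    ⟨hx, LinearMap.congr_fun (hlc.1 (a + 1)).2 x⟩
  rwa [hlc.2 a, Submodule.mem_bot] at hmem

theorem LinkedChain.upPow_succ_eq_zero_iff (hlc : LinkedChain up down) (n : ℕ) (i : ℤ)
    (x : V i) : upPow up (n + 1) i x = 0 ↔ up i x = 0 := by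
  induction n with
  | zero =>
    simp only [upPow, LinearMap.comp_apply, castMap_eq_zero_iff]
    exact up_castMap_eq_zero_iff up _ x
  | succ n ih =>
    rw [← ih]
    constructor
    · intro hx
      rw [upPow, LinearMap.comp_apply, LinearMap.comp_apply, castMap_eq_zero_iff] at hx
      rw [upPow, LinearMap.comp_apply, LinearMap.comp_apply] at hx ⊢
      rw [hlc.eq_zero_of_up_up _ _ hx, map_zero]
    · intro hx
      rw [upPow, LinearMap.comp_apply, LinearMap.comp_apply, hx, map_zero, map_zero]

theorem LinkedChain.downPow_succ_eq_zero_iff (hlc : LinkedChain up down) (n : ℕ) (i : ℤ)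
    (x : V (i + (n + 1 : ℕ))) :
    downPow down (n + 1) i x = 0 ↔
      down (i + n) (castMap (k := k) (by push_cast; ring) x) = 0 := by
  induction n with
  | zero =>
    simp only [downPow, LinearMap.comp_apply, castMap_eq_zero_iff]
  | succ n ih =>
    rw [downPow, LinearMap.comp_apply, LinearMap.comp_apply, ih]
    constructor
    · exact hlc.eq_zero_of_down_down _ _
    · intro hx
      rw [hx, map_zero, map_zero]

end LinkedChain

theorem transfer_eq_upPow (up : ∀ i : ℤ, V i →ₗ[k] V (i + 1))
    (down : ∀ i : ℤ, V (i + 1) →ₗ[k] V i) {i j : ℤ} (n : ℕ) (h : i + n = j) :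
    transfer up down i j = castMap h ∘ₗ upPow up n i := by
  obtain rfl : (j - i).toNat = n := by omega
  rw [transfer, dif_pos (by omega)]

theorem transfer_eq_downPow (up : ∀ i : ℤ, V i →ₗ[k] V (i + 1))
    (down : ∀ i : ℤ, V (i + 1) →ₗ[k] V i) {i j : ℤ} (n : ℕ) (h : i = j + n) (hji : j < i) :
    transfer up down i j = downPow down n j ∘ₗ castMap h := by
  obtain rfl : (i - j).toNat = n := by omega
  rw [transfer, dif_neg (by omega)]

/-- For a linked chain, the kernel of a composition of transfer maps is the
kernel of the first map applied: for `i < j`, `ker (v^i_j) = ker (v^i)` and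
`ker (v^j_i) = ker (v_{j-1})` (the latter stated with `j = l + 1`, `i ≤ l`). -/
theorem kernel_transfer_of_linkedChain
    (V : ℤ → Type v) [∀ i, AddCommGroup (V i)] [∀ i, Module k (V i)]
    [∀ i, FiniteDimensional k (V i)]
    (up : ∀ i : ℤ, V i →ₗ[k] V (i + 1)) (down : ∀ i : ℤ, V (i + 1) →ₗ[k] V i)
    (hlc : LinkedChain up down) :
    (∀ i j : ℤ, i < j → LinearMap.ker (transfer up down i j) = LinearMap.ker (up i)) ∧
    (∀ i l : ℤ, i ≤ l → LinearMap.ker (transfer up down (l + 1) i) = LinearMap.ker (down l)) := by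
  refine ⟨fun i j hij => ?_, fun i l hil => ?_⟩
  · ext x
    obtain ⟨n, hn⟩ : ∃ n : ℕ, i + (n + 1 : ℕ) = j := ⟨(j - i - 1).toNat, by omega⟩
    rw [LinearMap.mem_ker, LinearMap.mem_ker, transfer_eq_upPow up down _ hn,
      LinearMap.comp_apply, castMap_eq_zero_iff, hlc.upPow_succ_eq_zero_iff]
  · ext x
    obtain ⟨n, rfl⟩ : ∃ n : ℕ, l = i + n := ⟨(l - i).toNat, by omega⟩
    rw [LinearMap.mem_ker, LinearMap.mem_ker,
      transfer_eq_downPow up down (n + 1) (by push_cast; ring) (by omega),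
      LinearMap.comp_apply, hlc.downPow_succ_eq_zero_iff, down_castMap_castMap_eq_zero_iff]
    rfl

end ZChain
end

section
/- Every exact nontrivial linked chain of finite support over a field k is equivalent (up to isomorphism of representations and translation of the index) to the standard representation 𝔲(r) for a unique tuple r = (r_0, …, r_d) of nonnegative integers with r_0 ≠ 0 and r_d ≠ 0. That is: there exists such a tuple r and an equivalence with 𝔲(r), and if the chain is equivalent to both 𝔲(r) and 𝔲(r') then r = r'. -/
open LinearMap Submodule Module

namespace ZChain

universe u v

variable {k : Type u} [Field k]

variable {V : ℤ → Type v} [∀ i, AddCommGroup (V i)] [∀ i, Module k (V i)]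

/-- `Rsum r n = r 0 + ⋯ + r n`. -/
def Rsum (r : ℕ → ℕ) (n : ℕ) : ℕ := ∑ m ∈ Finset.range (n + 1), r m

/-- The diagonal map on `k^rr` which is the identity on the first `c` coordinates and zero on
the remaining ones. -/
def diagKeep (rr c : ℕ) : (Fin rr → k) →ₗ[k] (Fin rr → k) :=
  LinearMap.pi fun l => if (l : ℕ) < c then LinearMap.proj l else 0

/-- The diagonal map on `k^rr` which is zero on the first `c` coordinates and the identity on
the remaining ones. -/
def diagKill (rr c : ℕ) : (Fin rr → k) →ₗ[k] (Fin rr → k) :=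
  LinearMap.pi fun l => if (l : ℕ) < c then 0 else LinearMap.proj l

/-- The upward maps of the standard representation `𝔲(r)` attached to the tuple
`(r 0, …, r d)`: zero for `i < 0`, the identity for `i ≥ d`, and for `0 ≤ i < d` the diagonal
map which is the identity on the first `R_i` coordinates and zero on the rest. -/
def stdUp (r : ℕ → ℕ) (d : ℕ) (i : ℤ) :
    (Fin (Rsum r d) → k) →ₗ[k] (Fin (Rsum r d) → k) :=
  if i < 0 then 0 else if (d : ℤ) ≤ i then LinearMap.id
  else diagKeep (Rsum r d) (Rsum r i.toNat)

/-- The downward maps of the standard representation `𝔲(r)`: the identity for `i < 0`, zero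
for `i ≥ d`, and for `0 ≤ i < d` the diagonal map which is zero on the first `R_i`
coordinates and the identity on the rest. -/
def stdDown (r : ℕ → ℕ) (d : ℕ) (i : ℤ) :
    (Fin (Rsum r d) → k) →ₗ[k] (Fin (Rsum r d) → k) :=
  if i < 0 then LinearMap.id else if (d : ℤ) ≤ i then 0
  else diagKill (Rsum r d) (Rsum r i.toNat)

/-- The representation `(V, up, down)` is equivalent (up to isomorphism of representations
and translation of the index) to the standard representation `𝔲(r)` of the tuple
`(r 0, …, r d)`. -/
def EquivToStd {V : ℤ → Type v} [∀ i, AddCommGroup (V i)] [∀ i, Module k (V i)]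
    (up : ∀ i : ℤ, V i →ₗ[k] V (i + 1)) (down : ∀ i : ℤ, V (i + 1) →ₗ[k] V i)
    (r : ℕ → ℕ) (d : ℕ) : Prop :=
  ∃ (t : ℤ) (φ : ∀ i : ℤ, V i ≃ₗ[k] (Fin (Rsum r d) → k)),
    ∀ i : ℤ,
      (φ (i + 1)).toLinearMap ∘ₗ up i = stdUp r d (i + t) ∘ₗ (φ i).toLinearMap ∧
      (φ i).toLinearMap ∘ₗ down i = stdDown r d (i + t) ∘ₗ (φ (i + 1)).toLinearMap

section Standard

theorem diagKeep_single (n c : ℕ) (l : Fin n) :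
    diagKeep n c (Pi.single l (1 : k)) = if (l : ℕ) < c then Pi.single l 1 else 0 := by
  ext m
  by_cases hm : m = l
  · subst hm
    by_cases h : (m : ℕ) < c <;> simp [diagKeep, h]
  · by_cases h : (m : ℕ) < c <;> by_cases h' : (l : ℕ) < c <;> simp [diagKeep, h, h', hm]

theorem diagKill_single (n c : ℕ) (l : Fin n) :
    diagKill n c (Pi.single l (1 : k)) = if (l : ℕ) < c then 0 else Pi.single l 1 := by
  ext m
  by_cases hm : m = l
  · subst hm
    by_cases h : (m : ℕ) < c <;> simp [diagKill, h]
  · by_cases h : (m : ℕ) < c <;> by_cases h' : (l : ℕ) < c <;> simp [diagKill, h, h', hm]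

theorem diagKeep_zero (n : ℕ) : diagKeep (k := k) n 0 = 0 := by
  ext; simp [diagKeep]

theorem diagKill_zero (n : ℕ) : diagKill (k := k) n 0 = LinearMap.id := by
  ext; simp [diagKill]

theorem diagKeep_of_le {n c : ℕ} (h : n ≤ c) : diagKeep (k := k) n c = LinearMap.id := by
  refine LinearMap.ext fun x => funext fun l => ?_
  simp [diagKeep, l.2.trans_le h]

theorem diagKill_of_le {n c : ℕ} (h : n ≤ c) : diagKill (k := k) n c = 0 := by
  refine LinearMap.ext fun x => funext fun l => ?_
  simp [diagKill, l.2.trans_le h]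

theorem finrank_range_diagKeep {n c : ℕ} (h : c ≤ n) :
    finrank k (range (diagKeep (k := k) n c)) = c := by
  classical
  have hd : diagKeep (k := k) n c =
      Matrix.toLin' (Matrix.diagonal fun l : Fin n => if (l : ℕ) < c then (1 : k) else 0) := by
    refine LinearMap.ext fun x => funext fun l => ?_
    by_cases hl : (l : ℕ) < c <;> simp [diagKeep, hl, Matrix.mulVec_diagonal]
  have hr := Matrix.rank_diagonal fun l : Fin n => if (l : ℕ) < c then (1 : k) else 0
  rw [Matrix.rank, ← Matrix.toLin'_apply', ← hd] at hr
  rw [hr, Fintype.card_subtype]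
  simp [Fin.card_filter_val_lt, h]

theorem Rsum_mono (r : ℕ → ℕ) : Monotone (Rsum r) := fun a b h =>
  Finset.sum_le_sum_of_subset (Finset.range_mono (by omega))

theorem Rsum_succ (r : ℕ → ℕ) (n : ℕ) : Rsum r (n + 1) = Rsum r n + r (n + 1) :=
  Finset.sum_range_succ _ _

theorem Rsum_zero (r : ℕ → ℕ) : Rsum r 0 = r 0 := by
  simp [Rsum]

theorem Rsum_injective : Function.Injective Rsum := by
  intro r r' h
  funext n
  cases n with
  | zero => simpa [Rsum_zero] using congrFun h 0
  | succ n =>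
    have h1 := congrFun h n
    have h2 := congrFun h (n + 1)
    rw [Rsum_succ, Rsum_succ] at h2
    omega

theorem Rsum_eq_of_le {r : ℕ → ℕ} {d : ℕ} (hr : ∀ m, d < m → r m = 0) {n : ℕ} (h : d ≤ n) :
    Rsum r n = Rsum r d := by
  induction n, h using Nat.le_induction with
  | base => rfl
  | succ n hn ih => rw [Rsum_succ, ih, hr _ (by omega), add_zero]

/-- The rank of the `i`-th upward map of `𝔲(r)`. -/
def stdRank (r : ℕ → ℕ) (i : ℤ) : ℕ := if i < 0 then 0 else Rsum r i.toNat

theorem stdRank_le {r : ℕ → ℕ} {d : ℕ} (hr : ∀ m, d < m → r m = 0) (i : ℤ) :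
    stdRank r i ≤ Rsum r d := by
  unfold stdRank
  split_ifs
  · exact Nat.zero_le _
  · rcases le_total d i.toNat with h | h
    · exact (Rsum_eq_of_le hr h).le
    · exact Rsum_mono r h

theorem stdUp_eq_diagKeep {r : ℕ → ℕ} {d : ℕ} (hr : ∀ m, d < m → r m = 0) (i : ℤ) :
    stdUp (k := k) r d i = diagKeep (Rsum r d) (stdRank r i) := by
  unfold stdUp stdRank
  split_ifs with h1 h2
  · rw [diagKeep_zero]
  · rw [diagKeep_of_le (Rsum_eq_of_le hr (by omega)).ge]
  · rfl

theorem stdDown_eq_diagKill {r : ℕ → ℕ} {d : ℕ} (hr : ∀ m, d < m → r m = 0) (i : ℤ) :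
    stdDown (k := k) r d i = diagKill (Rsum r d) (stdRank r i) := by
  unfold stdDown stdRank
  split_ifs with h1 h2
  · rw [diagKill_zero]
  · rw [diagKill_of_le (Rsum_eq_of_le hr (by omega)).ge]
  · rfl

theorem stdRank_ne_zero_iff {r : ℕ → ℕ} (h0 : r 0 ≠ 0) (i : ℤ) : stdRank r i ≠ 0 ↔ 0 ≤ i := by
  unfold stdRank
  split_ifs with h
  · simp [h]
  · have := Rsum_mono r (Nat.zero_le i.toNat)
    rw [Rsum_zero] at this
    omega

theorem stdRank_natCast (r : ℕ → ℕ) (n : ℕ) : stdRank r n = Rsum r n := by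
  simp [stdRank]

theorem eq_of_stdRank_shift {r r' : ℕ → ℕ} {t t' : ℤ} (h0 : r 0 ≠ 0) (h0' : r' 0 ≠ 0)
    (h : ∀ i, stdRank r (i + t) = stdRank r' (i + t')) : r = r' := by
  have hiff : ∀ i : ℤ, 0 ≤ i + t ↔ 0 ≤ i + t' := fun i => by
    rw [← stdRank_ne_zero_iff h0, ← stdRank_ne_zero_iff h0', h]
  have h1 := hiff (-t)
  have h2 := hiff (-t')
  obtain rfl : t = t' := by omega
  refine Rsum_injective (funext fun n => ?_)
  have := h (n - t)
  rwa [sub_add_cancel, stdRank_natCast, stdRank_natCast] at this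

/-- A monotone function `ℤ → ℕ` vanishing far to the left and stabilising at its maximum `N > 0`
is, up to translation, the rank function of a standard representation. -/
theorem exists_stdRank_eq {a : ℤ → ℕ} (ha : Monotone a) {N : ℕ} (hN : 0 < N) {L M : ℤ}
    (hL : ∀ i < L, a i = 0) (hM : ∀ i, M ≤ i → a i = N) :
    ∃ (d : ℕ) (r : ℕ → ℕ) (t : ℤ), (r 0 ≠ 0 ∧ r d ≠ 0 ∧ ∀ m, d < m → r m = 0) ∧
      Rsum r d = N ∧ ∀ i, a i = stdRank r (i + t) := by
  obtain ⟨m, hm, hmin⟩ := Int.exists_least_of_bdd (P := fun i => a i ≠ 0)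
    ⟨L, fun z hz => not_lt.1 fun h => hz (hL z h)⟩ ⟨M, by rw [hM M le_rfl]; omega⟩
  obtain ⟨n, hn, nmin⟩ := Int.exists_least_of_bdd (P := fun i => a i = N)
    ⟨L, fun z hz => not_lt.1 fun h => by have := hL z h; omega⟩ ⟨M, hM M le_rfl⟩
  have hmn : m ≤ n := hmin n (by omega)
  have hlt : ∀ i < m, a i = 0 := fun i hi => by
    by_contra h
    exact absurd (hmin i h) (by omega)
  have hge : ∀ i, n ≤ i → a i = N := fun i hi => by
    have h1 := ha hi
    have h2 := ha (le_max_left i M)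
    rw [hM _ (le_max_right i M)] at h2
    omega
  let r : ℕ → ℕ := fun j => a (m + j) - a (m + j - 1)
  have hR : ∀ j : ℕ, Rsum r j = a (m + j) := by
    intro j
    induction j with
    | zero =>
      rw [Rsum_zero]
      simp only [r]
      rw [hlt (m + (0 : ℕ) - 1) (by simp), Nat.sub_zero]
    | succ j ih =>
      rw [Rsum_succ, ih]
      simp only [r]
      rw [show m + ((j + 1 : ℕ) : ℤ) - 1 = m + j by push_cast; ring]
      have := ha (show m + (j : ℤ) ≤ m + ((j + 1 : ℕ) : ℤ) by push_cast; omega)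
      omega
  have hd : m + ((n - m).toNat : ℤ) = n := by omega
  refine ⟨(n - m).toNat, r, -m, ⟨?_, ?_, ?_⟩, ?_, ?_⟩
  · rw [← Rsum_zero r, hR]
    simpa using hm
  · simp only [r]
    rw [hd, hn]
    have h1 : a (n - 1) ≠ N := fun h => absurd (nmin _ h) (by omega)
    have h2 := ha (show n - 1 ≤ n by omega)
    omega
  · intro j hj
    simp only [r]
    rw [hge _ (by omega), hge _ (by omega), Nat.sub_self]
  · rw [hR, hd, hn]
  · intro i
    unfold stdRank
    split_ifs with h
    · exact hlt i (by omega)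
    · rw [hR]
      congr 1
      omega

end Standard

section Transfer

variable {up : ∀ i : ℤ, V i →ₗ[k] V (i + 1)} {down : ∀ i : ℤ, V (i + 1) →ₗ[k] V i}

theorem castMap_bijective {i j : ℤ} (h : i = j) :
    Function.Bijective (castMap (k := k) (V := V) h) := by
  subst h
  exact Function.bijective_id

theorem surjective_up_of_upPow {n : ℕ} {i : ℤ} (h : Function.Surjective (upPow up (n + 1) i)) :
    Function.Surjective (up (i + n)) := by
  rw [upPow, LinearMap.coe_comp, LinearMap.coe_comp] at h
  exact (h.of_comp_left (castMap_bijective _).injective).of_comp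

theorem surjective_down_of_downPow {n : ℕ} {i : ℤ}
    (h : Function.Surjective (downPow down (n + 1) i)) : Function.Surjective (down i) := by
  induction n with
  | zero =>
    rw [downPow, downPow, LinearMap.coe_comp, LinearMap.coe_comp, ← Function.comp_assoc] at h
    have h' := h.of_comp
    have key : ∀ (j : ℤ) (e : j = i), Function.Surjective (castMap (k := k) e ∘ down j) →
        Function.Surjective (down i) := by
      rintro j rfl hj
      exact hj
    exact key _ _ h'
  | succ n ih =>
    rw [downPow, LinearMap.coe_comp] at h
    exact ih h.of_comp

theorem surjective_up_of_transfer {i j : ℤ} (hij : j ≤ i)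
    (h : Function.Surjective (transfer up down j (i + 1))) : Function.Surjective (up i) := by
  obtain ⟨n, rfl⟩ := Int.le.dest hij
  have hn : (j + n + 1 - j).toNat = n + 1 := by omega
  rw [transfer, dif_pos (by omega), LinearMap.coe_comp] at h
  have h' := h.of_comp_left (castMap_bijective _).injective
  rw [hn] at h'
  exact surjective_up_of_upPow h'

theorem surjective_down_of_transfer {i j : ℤ} (hij : i < j)
    (h : Function.Surjective (transfer up down j i)) : Function.Surjective (down i) := by
  obtain ⟨n, hn⟩ : ∃ n, (j - i).toNat = n + 1 := ⟨(j - i).toNat - 1, by omega⟩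
  rw [transfer, dif_neg (by omega), LinearMap.coe_comp] at h
  have h' := h.of_comp
  rw [hn] at h'
  exact surjective_down_of_downPow h'

theorem RepSupport.exists_surjective {H : Finset ℤ} (hH : RepSupport up down ↑H) :
    ∃ L M : ℤ, (∀ i < L, Function.Surjective (down i)) ∧
      ∀ i, M ≤ i → Function.Surjective (up i) := by
  obtain ⟨L, hL⟩ := H.bddBelow
  obtain ⟨M, hM⟩ := H.bddAbove
  refine ⟨L, M, fun i hi => ?_, fun i hi => ?_⟩
  · obtain ⟨j, hj, hs⟩ := hH i
    exact surjective_down_of_transfer (hi.trans_le (hL hj)) hs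
  · obtain ⟨j, hj, hs⟩ := hH (i + 1)
    exact surjective_up_of_transfer ((hM hj).trans hi) hs

end Transfer

section Exact

variable {up : ∀ i : ℤ, V i →ₗ[k] V (i + 1)} {down : ∀ i : ℤ, V (i + 1) →ₗ[k] V i}

/-- There is a family of vectors through a given vector at vertex `j` which is compatible with
the upward maps above `j` and with the downward maps below `j`. -/
theorem exists_transfer_family (up : ∀ i : ℤ, V i →ₗ[k] V (i + 1))
    (down : ∀ i : ℤ, V (i + 1) →ₗ[k] V i) (j : ℤ) (w : V j) :
    ∃ x : ∀ i, V i, x j = w ∧ (∀ i, j ≤ i → up i (x i) = x (i + 1)) ∧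
      ∀ i, i < j → down i (x (i + 1)) = x i := by
  let x : ∀ i, V i := fun i => i.inductionOn' (motive := V) j w (fun n _ y => up n y)
    (fun n _ y => down (n - 1) ((sub_add_cancel n 1).symm ▸ y))
  refine ⟨x, Int.inductionOn'_self, fun i hi => (Int.inductionOn'_add_one hi).symm, ?_⟩
  have key : ∀ (z i : ℤ) (h : z = i + 1), z ≤ j → x i = down i (h ▸ x z) := by
    intro z i h hz
    obtain rfl : i = z - 1 := by omega
    exact Int.inductionOn'_sub_one hz
  exact fun i hi => (key (i + 1) i rfl (by omega)).symm

/-- A subrepresentation of a special chain which is zero upwards far to the left and zero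
downwards far to the right is everything if it generates modulo the images of the arrows. -/
theorem SpecialChain.subrep_eq_top (hsp : SpecialChain up down) {L M : ℤ}
    (hL : ∀ i < L, up i = 0) (hM : ∀ i, M ≤ i → down i = 0)
    {U : ∀ i, Submodule k (V i)} (hU : IsSubrep up down U)
    (hgen : ∀ i, U (i + 1) ⊔ range (up i) ⊔ range (down (i + 1)) = ⊤) (i : ℤ) : U i = ⊤ := by
  have hdec : ∀ (i : ℤ) (x : V (i + 1)), ∃ u ∈ U (i + 1), ∃ y z,
      u + up i y + down (i + 1) z = x := by
    intro i x
    have hx : x ∈ U (i + 1) ⊔ range (up i) ⊔ range (down (i + 1)) := hgen i ▸ mem_top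
    obtain ⟨p, hp, _, ⟨z, rfl⟩, rfl⟩ := mem_sup.1 hx
    obtain ⟨u, hu, _, ⟨y, rfl⟩, rfl⟩ := mem_sup.1 hp
    exact ⟨u, hu, y, z, rfl⟩
  have hup : ∀ (n : ℕ) (i : ℤ), i < L + n → ∀ x, up i x ∈ U (i + 1) := by
    intro n
    induction n with
    | zero =>
      intro i hi x
      simp [hL i (by simpa using hi)]
    | succ n ih =>
      intro i hi x
      obtain ⟨i, rfl⟩ : ∃ j, i = j + 1 := ⟨i - 1, by ring⟩
      obtain ⟨u, hu, y, z, rfl⟩ := hdec i x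
      have h0 : up (i + 1) (down (i + 1) z) = 0 := LinearMap.congr_fun (hsp (i + 1)).2 z
      rw [map_add, h0, add_zero]
      exact (hU (i + 1)).1 _ (add_mem hu (ih i (by push_cast at hi; omega) y))
  have hdown : ∀ (n : ℕ) (i : ℤ), M ≤ i + n → ∀ x, down i x ∈ U i := by
    intro n
    induction n with
    | zero =>
      intro i hi x
      simp [hM i (by simpa using hi)]
    | succ n ih =>
      intro i hi x
      obtain ⟨u, hu, y, z, rfl⟩ := hdec i x
      have h0 : down i (up i y) = 0 := LinearMap.congr_fun (hsp i).1 y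
      rw [map_add, map_add, h0, add_zero, ← map_add]
      exact (hU i).2 _ (add_mem hu (ih (i + 1) (by push_cast at hi; omega) z))
  obtain ⟨i, rfl⟩ : ∃ j, i = j + 1 := ⟨i - 1, by ring⟩
  refine eq_top_iff.2 fun x _ => ?_
  obtain ⟨u, hu, y, z, rfl⟩ := hdec i x
  exact add_mem (add_mem hu (hup (i + 1 - L).toNat i (by omega) y))
    (hdown (M - i).toNat (i + 1) (by omega) z)

theorem LinkedChain.disjoint_range (hlc : LinkedChain up down) (hex : ExactRep up down) (i : ℤ) :
    Disjoint (range (up i)) (range (down (i + 1))) := by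
  rw [disjoint_iff, ← (hex i).2, ← (hex (i + 1)).1]
  exact hlc.2 i

variable [∀ i, FiniteDimensional k (V i)]

theorem ExactRep.finrank_range_add (hex : ExactRep up down) (i : ℤ) :
    finrank k (range (up i)) + finrank k (range (down i)) = finrank k (V i) := by
  rw [← (hex i).1]
  exact finrank_range_add_finrank_ker _

theorem ExactRep.finrank_succ (hex : ExactRep up down) (i : ℤ) :
    finrank k (V (i + 1)) = finrank k (V i) := by
  rw [← hex.finrank_range_add i, ← finrank_range_add_finrank_ker (down i), (hex i).2, add_comm]

theorem ExactRep.finrank_eq (hex : ExactRep up down) (i : ℤ) :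
    finrank k (V i) = finrank k (V 0) := by
  induction i using Int.induction_on with
  | zero => rfl
  | succ i ih => rw [hex.finrank_succ, ih]
  | pred i ih =>
    have h : ∀ j m : ℤ, j + 1 = m → finrank k (V j) = finrank k (V m) := by
      rintro j _ rfl
      exact (hex.finrank_succ j).symm
    rw [h _ (-(i : ℤ)) (by ring), ih]

theorem LinkedChain.monotone_finrank_range (hlc : LinkedChain up down) (hex : ExactRep up down) :
    Monotone fun i => finrank k (range (up i)) := by
  refine monotone_int_of_le_succ fun i => ?_
  have h1 := Submodule.finrank_add_finrank_le_of_disjoint (hlc.disjoint_range hex i)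
  have h2 := hex.finrank_range_add (i + 1)
  omega

theorem exists_span_image_Ico_eq {E : Type*} [AddCommGroup E] [Module k E] [FiniteDimensional k E]
    (W : Submodule k E) {a b : ℕ} (h : a + finrank k W = b) :
    ∃ w : ℕ → E, span k (w '' Set.Ico a b) = W := by
  let B := finBasis k W
  refine ⟨fun l => if hl : l - a < finrank k W then (B ⟨l - a, hl⟩ : E) else 0, ?_⟩
  apply le_antisymm
  · rw [span_le]
    rintro _ ⟨l, -, rfl⟩
    dsimp only
    split_ifs
    · exact SetLike.coe_mem _
    · exact zero_mem W
  · have hB : W = span k (Set.range fun m => (B m : E)) := by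
      rw [Set.range_comp' Subtype.val B]
      change W = span k (W.subtype '' _)
      rw [span_image, B.span_eq, map_subtype_top]
    conv_lhs => rw [hB]
    refine span_mono ?_
    rintro _ ⟨m, rfl⟩
    refine ⟨a + m, ⟨by omega, by omega⟩, ?_⟩
    simp

theorem LinkedChain.exists_generators (hlc : LinkedChain up down) (hex : ExactRep up down)
    (i : ℤ) : ∃ w : ℕ → V (i + 1),
      span k (w '' Set.Ico (finrank k (range (up i))) (finrank k (range (up (i + 1))))) ⊔
        range (up i) ⊔ range (down (i + 1)) = ⊤ := by
  obtain ⟨W, hW⟩ := Submodule.exists_isCompl (range (up i) ⊔ range (down (i + 1)))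
  have h1 := Submodule.finrank_add_eq_of_isCompl hW
  have h2 := Submodule.finrank_sup_add_finrank_inf_eq (range (up i)) (range (down (i + 1)))
  rw [(hlc.disjoint_range hex i).eq_bot, finrank_bot] at h2
  have h3 := hex.finrank_range_add (i + 1)
  obtain ⟨w, hw⟩ := exists_span_image_Ico_eq W (a := finrank k (range (up i)))
    (b := finrank k (range (up (i + 1)))) (by omega)
  refine ⟨w, ?_⟩
  rw [hw, sup_assoc, sup_comm]
  exact hW.sup_eq_top

/-- An exact linked chain whose outer maps are surjective admits coordinates in which all maps
are diagonal, the ranks of the upward maps being the only parameters. -/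
theorem LinkedChain.exists_diagonal_coordinates (hlc : LinkedChain up down)
    (hex : ExactRep up down) {N : ℕ} (hN : ∀ i, finrank k (V i) = N) {L M : ℤ}
    (hL : ∀ i < L, finrank k (range (up i)) = 0)
    (hM : ∀ i, M ≤ i → finrank k (range (up i)) = N) :
    ∃ φ : ∀ i, V i ≃ₗ[k] (Fin N → k), ∀ i,
      (φ (i + 1)).toLinearMap ∘ₗ up i =
        diagKeep N (finrank k (range (up i))) ∘ₗ (φ i).toLinearMap ∧
      (φ i).toLinearMap ∘ₗ down i =
        diagKill N (finrank k (range (up i))) ∘ₗ (φ (i + 1)).toLinearMap := by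
  have hmono := hlc.monotone_finrank_range hex
  have hrank := hex.finrank_range_add
  choose w hw using hlc.exists_generators hex
  let a : ℤ → ℕ := fun i => finrank k (range (up i))
  have hbirth : ∀ l : Fin N, ∃ j, a j ≤ l ∧ l < a (j + 1) := by
    intro l
    obtain ⟨j, hj, hmin⟩ := Int.exists_least_of_bdd (P := fun i => (l : ℕ) < a i)
      ⟨L, fun z hz => not_lt.1 fun h => by have := hL z h; simp only [a] at hz; omega⟩
      ⟨M, by simp only [a]; rw [hM M le_rfl]; exact l.2⟩
    refine ⟨j - 1, not_lt.1 fun h => absurd (hmin _ h) (by omega), ?_⟩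
    rwa [sub_add_cancel]
  choose β hβ hβ' using hbirth
  choose x hx hxup hxdown using fun l : Fin N =>
    exists_transfer_family up down (β l + 1) (w (β l) l)
  have hlt : ∀ (l : Fin N) (i : ℤ), (l : ℕ) < a i ↔ β l + 1 ≤ i := fun l i =>
    ⟨fun h => not_lt.1 fun hi => absurd (h.trans_le (hmono (show i ≤ β l by omega)))
      (not_lt.2 (hβ l)), fun h => (hβ' l).trans_le (hmono h)⟩
  have hupx : ∀ l i, up i (x l i) = if (l : ℕ) < a i then x l (i + 1) else 0 := by
    intro l i
    split_ifs with h
    · exact hxup l i ((hlt l i).1 h)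
    · rw [← hxdown l i (by rw [hlt] at h; omega)]
      exact LinearMap.congr_fun (hlc.1 i).2 _
  have hdownx : ∀ l i, down i (x l (i + 1)) = if (l : ℕ) < a i then 0 else x l i := by
    intro l i
    split_ifs with h
    · rw [← hxup l i ((hlt l i).1 h)]
      exact LinearMap.congr_fun (hlc.1 i).1 _
    · exact hxdown l i (by rw [hlt] at h; omega)
  have hspan : ∀ i, span k (Set.range fun l => x l i) = ⊤ := by
    refine hlc.1.subrep_eq_top (L := L) (M := M) ?_ ?_ ?_ ?_
    · intro i hi
      exact LinearMap.range_eq_bot.1 (finrank_eq_zero.1 (hL i hi))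
    · intro i hi
      have := hrank i
      rw [hM i hi, hN] at this
      exact LinearMap.range_eq_bot.1 (finrank_eq_zero.1 (by omega))
    · intro i
      refine ⟨fun y hy => ?_, fun y hy => ?_⟩
      · change y ∈ (span k (Set.range fun l => x l (i + 1))).comap (up i)
        refine span_le.2 ?_ hy
        rintro _ ⟨l, rfl⟩
        change up i (x l i) ∈ span k _
        rw [hupx]
        split_ifs
        · exact subset_span ⟨l, rfl⟩
        · exact zero_mem _
      · change y ∈ (span k (Set.range fun l => x l i)).comap (down i)
        refine span_le.2 ?_ hy
        rintro _ ⟨l, rfl⟩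
        change down i (x l (i + 1)) ∈ span k _
        rw [hdownx]
        split_ifs
        · exact zero_mem _
        · exact subset_span ⟨l, rfl⟩
    · intro i
      rw [eq_top_iff, ← hw i]
      refine sup_le_sup_right (sup_le_sup_right (span_mono ?_) _) _
      rintro _ ⟨l, ⟨hl, hl'⟩, rfl⟩
      have hlN : l < N := by
        have := hrank (i + 1)
        rw [hN] at this
        omega
      refine ⟨⟨l, hlN⟩, ?_⟩
      have h1 := (hlt ⟨l, hlN⟩ (i + 1)).1 hl'
      have h2 := (hlt ⟨l, hlN⟩ i).not.1 (not_lt.2 hl)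
      have hi : β ⟨l, hlN⟩ = i := by omega
      have h3 := hx ⟨l, hlN⟩
      rw [hi] at h3
      exact h3
  let b : ∀ i, Basis (Fin N) k (V i) := fun i =>
    basisOfTopLeSpanOfCardEqFinrank (fun l => x l i) (hspan i).ge (by simp [hN])
  have hb : ∀ i l, b i l = x l i := fun i l => by simp [b]
  have hbs : ∀ i l, (b i).equivFun (x l i) = Pi.single l 1 := fun i l => by
    rw [← hb]
    ext m
    simp [Pi.single_apply, eq_comm]
  refine ⟨fun i => (b i).equivFun, fun i => ⟨(b i).ext fun l => ?_, (b (i + 1)).ext fun l => ?_⟩⟩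
  · simp only [LinearMap.comp_apply, LinearEquiv.coe_coe, hb, hbs, hupx, diagKeep_single]
    split_ifs <;> simp [hbs]
  · simp only [LinearMap.comp_apply, LinearEquiv.coe_coe, hb, hbs, hdownx, diagKill_single]
    split_ifs <;> simp [hbs]

end Exact

theorem exists_finrank_range_eq_of_equivToStd {up : ∀ i : ℤ, V i →ₗ[k] V (i + 1)}
    {down : ∀ i : ℤ, V (i + 1) →ₗ[k] V i} {r : ℕ → ℕ} {d : ℕ} (hr : ∀ m, d < m → r m = 0)
    (h : EquivToStd up down r d) :
    ∃ t : ℤ, ∀ i, finrank k (range (up i)) = stdRank r (i + t) := by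
  obtain ⟨t, φ, hφ⟩ := h
  refine ⟨t, fun i => ?_⟩
  have h1 := (hφ i).1
  rw [stdUp_eq_diagKeep hr] at h1
  have h2 := congrArg (fun f => finrank k (range f)) h1
  rw [range_comp_of_range_eq_top _ (φ i).range, finrank_range_diagKeep (stdRank_le hr _),
    range_comp] at h2
  rw [← h2]
  exact ((φ (i + 1)).finrank_map_eq _).symm

/-- Every exact nontrivial linked chain of finite support is equivalent to
the standard representation `𝔲(r)` for a unique tuple `r = (r 0, …, r d)` of nonnegative
integers with `r 0 ≠ 0 ≠ r d` (a tuple is encoded as a function `ℕ → ℕ` vanishing beyond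
`d`). -/
theorem exact_linkedChain_equiv_std_unique
    (V : ℤ → Type v) [∀ i, AddCommGroup (V i)] [∀ i, Module k (V i)]
    [∀ i, FiniteDimensional k (V i)]
    (up : ∀ i : ℤ, V i →ₗ[k] V (i + 1)) (down : ∀ i : ℤ, V (i + 1) →ₗ[k] V i)
    (hlc : LinkedChain up down) (hex : ExactRep up down)
    (hnt : ∀ i : ℤ, Nontrivial (V i))
    (hfs : ∃ H : Finset ℤ, RepSupport up down ↑H) :
    (∃ (d : ℕ) (r : ℕ → ℕ), (r 0 ≠ 0 ∧ r d ≠ 0 ∧ ∀ m : ℕ, d < m → r m = 0) ∧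
      EquivToStd up down r d) ∧
    (∀ (d : ℕ) (r : ℕ → ℕ) (d' : ℕ) (r' : ℕ → ℕ),
      (r 0 ≠ 0 ∧ r d ≠ 0 ∧ ∀ m : ℕ, d < m → r m = 0) →
      (r' 0 ≠ 0 ∧ r' d' ≠ 0 ∧ ∀ m : ℕ, d' < m → r' m = 0) →
      EquivToStd up down r d → EquivToStd up down r' d' → d = d' ∧ r = r') := by
  constructor
  · obtain ⟨H, hH⟩ := hfs
    obtain ⟨L, M, hL, hM⟩ := hH.exists_surjective
    have hrank := hex.finrank_range_add
    have hL' : ∀ i < L, finrank k (range (up i)) = 0 := fun i hi => by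
      have h := hrank i
      rw [range_eq_top.2 (hL i hi), finrank_top] at h
      omega
    have hM' : ∀ i, M ≤ i → finrank k (range (up i)) = finrank k (V 0) := fun i hi => by
      rw [range_eq_top.2 (hM i hi), finrank_top, hex.finrank_eq]
    obtain ⟨d, r, t, hr, hN, ha⟩ := exists_stdRank_eq (hlc.monotone_finrank_range hex)
      (finrank_pos_iff.2 (hnt 0)) hL' hM'
    rw [← hN] at hM'
    obtain ⟨φ, hφ⟩ := hlc.exists_diagonal_coordinates hex
      (fun i => (hex.finrank_eq i).trans hN.symm) hL' hM'
    refine ⟨d, r, hr, t, φ, fun i => ?_⟩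
    rw [stdUp_eq_diagKeep hr.2.2, stdDown_eq_diagKill hr.2.2, ← ha]
    exact hφ i
  · intro d r d' r' hr hr' h h'
    obtain ⟨t, ht⟩ := exists_finrank_range_eq_of_equivToStd hr.2.2 h
    obtain ⟨t', ht'⟩ := exists_finrank_range_eq_of_equivToStd hr'.2.2 h'
    obtain rfl := eq_of_stdRank_shift hr.1 hr'.1 fun i => (ht i).symm.trans (ht' i)
    refine ⟨le_antisymm ?_ ?_, rfl⟩
    · exact not_lt.1 fun hlt => hr.2.1 (hr'.2.2 _ hlt)
    · exact not_lt.1 fun hlt => hr'.2.1 (hr.2.2 _ hlt)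

end ZChain
end

section
/- Let 𝔴 = (W_i, w_i, w^i) be a representation of the ℤ-quiver of pure dimension 1 over a field k, and set a^i = a^i(𝔴) and a_i = a_i(𝔴). Then 𝔴 is a linked chain with finite support if and only if there exists i ∈ ℤ such that a^i · a_i = 0, (a^j, a_j) = (0,1) for every j < i, and (a^j, a_j) = (1,0) for every j > i. -/
open LinearMap Submodule Module

namespace ZChain

universe u v

variable {k : Type u} [Field k]

variable {V : ℤ → Type v} [∀ i, AddCommGroup (V i)] [∀ i, Module k (V i)]

section Transfer

variable (up : ∀ i : ℤ, V i →ₗ[k] V (i + 1)) (down : ∀ i : ℤ, V (i + 1) →ₗ[k] V i)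

theorem castMap_surjective {i j : ℤ} (h : i = j) :
    Function.Surjective (castMap h : V i →ₗ[k] V j) := by
  subst h
  exact Function.surjective_id

theorem upPow_surjective (n : ℕ) (i : ℤ) (h : ∀ j, i ≤ j → Function.Surjective (up j)) :
    Function.Surjective (upPow up n i) := by
  induction n with
  | zero => exact castMap_surjective _
  | succ n ih =>
    exact (castMap_surjective _).comp ((h (i + n) (by omega)).comp ih)

theorem downPow_surjective (n : ℕ) (i : ℤ)
    (h : ∀ j, j < i + n → Function.Surjective (down j)) :
    Function.Surjective (downPow down n i) := by
  induction n with
  | zero => exact castMap_surjective _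
  | succ n ih =>
    refine (ih fun j hj => h j (by omega)).comp ?_
    exact (h (i + n) (by omega)).comp (castMap_surjective _)

theorem transfer_surjective_of_le {i j : ℤ} (hij : i ≤ j)
    (h : ∀ l, i ≤ l → Function.Surjective (up l)) :
    Function.Surjective (transfer up down i j) := by
  rw [transfer, dif_pos hij]
  exact (castMap_surjective _).comp (upPow_surjective up _ i h)

theorem transfer_surjective_of_ge {i j : ℤ} (hij : j ≤ i)
    (h : ∀ l, l < i → Function.Surjective (down l)) :
    Function.Surjective (transfer up down i j) := by
  obtain rfl | hlt := hij.eq_or_lt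
  · rw [transfer, dif_pos le_rfl]
    refine (castMap_surjective _).comp ?_
    rw [show (j - j).toNat = 0 by simp]
    exact castMap_surjective _
  · rw [transfer, dif_neg (by omega)]
    exact (downPow_surjective down _ j fun l hl => h l (by omega)).comp (castMap_surjective _)

theorem transfer_eq_zero_of_lt {i j : ℤ} (hij : i < j) (h : ∀ l, up l = 0) :
    transfer up down i j = 0 := by
  obtain ⟨n, hn⟩ : ∃ n, (j - i).toNat = n + 1 := ⟨(j - i).toNat - 1, by omega⟩
  have hz : upPow up (j - i).toNat i = 0 := by
    rw [hn, upPow, h, LinearMap.zero_comp, LinearMap.comp_zero]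
  rw [transfer, dif_pos hij.le, hz, LinearMap.comp_zero]

theorem transfer_eq_zero_of_gt {i j : ℤ} (hij : j < i) (h : ∀ l, down l = 0) :
    transfer up down i j = 0 := by
  obtain ⟨n, hn⟩ : ∃ n, (i - j).toNat = n + 1 := ⟨(i - j).toNat - 1, by omega⟩
  have hz : downPow down (i - j).toNat j = 0 := by
    rw [hn, downPow, h, LinearMap.zero_comp, LinearMap.comp_zero]
  rw [transfer, dif_neg (by omega), hz, LinearMap.zero_comp]

end Transfer

theorem not_surjective_zero_of_nontrivial {M N : Type v} [AddCommGroup M] [Module k M]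
    [AddCommGroup N] [Module k N] [Nontrivial N] :
    ¬ Function.Surjective (0 : M →ₗ[k] N) := fun h => by
  obtain ⟨y, hy⟩ := exists_ne (0 : N)
  obtain ⟨x, hx⟩ := h y
  exact hy hx.symm

theorem ker_eq_bot_of_ne_zero_of_finrank_eq_one {M N : Type v} [AddCommGroup M] [Module k M]
    [AddCommGroup N] [Module k N] (hM : finrank k M = 1) {f : M →ₗ[k] N} (hf : f ≠ 0) :
    ker f = ⊥ := by
  have := isSimpleModule_iff_finrank_eq_one.mpr hM
  exact LinearMap.ker_eq_bot.mpr (LinearMap.injective_of_ne_zero hf)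

/-- In a special chain of pure dimension 1, a nonzero arrow forces the opposite one to vanish. -/
theorem SpecialChain.up_eq_zero_or_down_eq_zero {up : ∀ i : ℤ, V i →ₗ[k] V (i + 1)}
    {down : ∀ i : ℤ, V (i + 1) →ₗ[k] V i} (hpure : ∀ i : ℤ, finrank k (V i) = 1)
    (h : SpecialChain up down) (i : ℤ) : up i = 0 ∨ down i = 0 := by
  by_contra! hne
  refine hne.1 (LinearMap.ext fun x => ?_)
  have hx : up i x ∈ ker (down i) := LinearMap.congr_fun (h i).1 x
  rwa [ker_eq_bot_of_ne_zero_of_finrank_eq_one (hpure _) hne.2] at hx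

/-- In a linked chain with nonzero spaces, the two arrows leaving a vertex do not both vanish. -/
theorem LinkedChain.up_ne_zero {up : ∀ i : ℤ, V i →ₗ[k] V (i + 1)}
    {down : ∀ i : ℤ, V (i + 1) →ₗ[k] V i} [∀ i, Nontrivial (V i)]
    (h : LinkedChain up down) {i : ℤ} (hi : down i = 0) : up (i + 1) ≠ 0 := fun hu => by
  have := h.2 i
  rw [hi, hu, LinearMap.ker_zero, LinearMap.ker_zero, inf_top_eq] at this
  exact top_ne_bot this

/-- A representation of pure dimension 1 is a linked chain with finite
support if and only if there is a vertex `i` with `a^i · a_i = 0`, `(a^j, a_j) = (0,1)` for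
`j < i` and `(a^j, a_j) = (1,0)` for `j > i` (where `a^j = 0` iff `w^j = 0` and `a_j = 0`
iff `w_j = 0`). -/
theorem pure_one_linkedChain_finite_support_iff
    (W : ℤ → Type v) [∀ i, AddCommGroup (W i)] [∀ i, Module k (W i)]
    [∀ i, FiniteDimensional k (W i)]
    (up : ∀ i : ℤ, W i →ₗ[k] W (i + 1)) (down : ∀ i : ℤ, W (i + 1) →ₗ[k] W i)
    (hpure : ∀ i : ℤ, Module.finrank k (W i) = 1) :
    (LinkedChain up down ∧ ∃ H : Finset ℤ, RepSupport up down ↑H) ↔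
      ∃ i : ℤ, (up i = 0 ∨ down i = 0) ∧
        (∀ j : ℤ, j < i → up j = 0 ∧ down j ≠ 0) ∧
        (∀ j : ℤ, i < j → up j ≠ 0 ∧ down j = 0) := by
  have hnt : ∀ i, Nontrivial (W i) := fun i =>
    Module.nontrivial_of_finrank_pos (R := k) (by rw [hpure i]; exact one_pos)
  constructor
  · rintro ⟨hl, H, hH⟩
    have hor := hl.1.up_eq_zero_or_down_eq_zero hpure
    have hstep : ∀ i, down i = 0 → down (i + 1) = 0 := fun i hi =>
      (hor (i + 1)).resolve_left (hl.up_ne_zero hi)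
    have hmono : ∀ i j, i ≤ j → down i = 0 → down j = 0 := fun i j hij hi =>
      Int.leInduction (motive := fun j _ => down j = 0) hi (fun j _ => hstep j) j hij
    obtain ⟨b, hb⟩ : ∃ b, down b ≠ 0 := by
      by_contra! hall
      obtain ⟨b, hb⟩ := H.bddBelow
      obtain ⟨j, hj, hs⟩ := hH (b - 1)
      have hbj : b ≤ j := hb hj
      rw [transfer_eq_zero_of_gt up down (by omega) hall] at hs
      exact not_surjective_zero_of_nontrivial hs
    obtain ⟨c, hc⟩ : ∃ c, down c = 0 := by
      by_contra! hall
      obtain ⟨b, hb⟩ := H.bddAbove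
      obtain ⟨j, hj, hs⟩ := hH (b + 1)
      have hbj : j ≤ b := hb hj
      rw [transfer_eq_zero_of_lt up down (by omega)
        fun l => (hor l).resolve_right (hall l)] at hs
      exact not_surjective_zero_of_nontrivial hs
    obtain ⟨i, hi, hmin⟩ := Int.exists_least_of_bdd (P := fun i => down i = 0)
      ⟨b, fun z hz => not_lt.mp fun hlt => hb (hmono z b hlt.le hz)⟩ ⟨c, hc⟩
    refine ⟨i, Or.inr hi, fun j hj => ?_, fun j hj => ⟨?_, hmono i j hj.le hi⟩⟩
    · have hne : down j ≠ 0 := fun h => (hmin j h).not_gt hj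
      exact ⟨(hor j).resolve_right hne, hne⟩
    · obtain ⟨l, rfl⟩ : ∃ l, j = l + 1 := ⟨j - 1, by omega⟩
      exact hl.up_ne_zero (hmono i l (by omega) hi)
  · rintro ⟨i, hi, hlt, hgt⟩
    refine ⟨⟨fun j => ?_, fun j => ?_⟩, {i, i + 1}, fun j => ?_⟩
    · have hor : up j = 0 ∨ down j = 0 := by
        rcases lt_trichotomy j i with h | rfl | h
        · exact Or.inl (hlt j h).1
        · exact hi
        · exact Or.inr (hgt j h).2
      rcases hor with h | h <;> simp [h]
    · rcases lt_or_ge j i with h | h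
      · rw [ker_eq_bot_of_ne_zero_of_finrank_eq_one (hpure _) (hlt j h).2, bot_inf_eq]
      · rw [ker_eq_bot_of_ne_zero_of_finrank_eq_one (hpure _) (hgt (j + 1) (by omega)).1,
          inf_bot_eq]
    · rcases le_or_gt j i with h | h
      · exact ⟨i, by simp, transfer_surjective_of_ge up down h fun l hl =>
          surjective_of_nonzero_of_finrank_eq_one (hpure _) (hlt l hl).2⟩
      · exact ⟨i + 1, by simp, transfer_surjective_of_le up down h fun l hl =>
          surjective_of_nonzero_of_finrank_eq_one (hpure _) (hgt l hl).1⟩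

end ZChain
end

section
/- Let 𝔴 = (W_i, w_i, w^i) be a representation of the ℤ-quiver of pure dimension 1 over a field k, and set a^i = a^i(𝔴) and a_i = a_i(𝔴). Then 𝔴 is an exact colinked chain with finite cosupport if and only if there exists i ∈ ℤ such that (a^j, a_j) = (1,0) for every j < i and (a^j, a_j) = (0,1) for every j ≥ i. -/
open LinearMap Submodule Module

namespace ZChain

universe u v

variable {k : Type u} [Field k]

variable {V : ℤ → Type v} [∀ i, AddCommGroup (V i)] [∀ i, Module k (V i)]

theorem castMap_injective {i j : ℤ} (h : i = j) :
    Function.Injective (castMap (k := k) (V := V) h) := by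
  subst h
  exact Function.injective_id

theorem upPow_injective {up : ∀ i : ℤ, V i →ₗ[k] V (i + 1)} (n : ℕ) (i : ℤ)
    (h : ∀ j, j < i + n → Function.Injective (up j)) : Function.Injective (upPow up n i) := by
  induction n with
  | zero => exact castMap_injective _
  | succ n ih =>
    exact (castMap_injective _).comp
      ((h _ (by push_cast; omega)).comp (ih fun j hj => h j (by push_cast; omega)))

theorem downPow_injective {down : ∀ i : ℤ, V (i + 1) →ₗ[k] V i} (n : ℕ) (i : ℤ)
    (h : ∀ j, i ≤ j → Function.Injective (down j)) : Function.Injective (downPow down n i) := by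
  induction n with
  | zero => exact castMap_injective _
  | succ n ih => exact ih.comp ((h _ (by omega)).comp (castMap_injective _))

theorem transfer_eq_zero_of_up_eq_zero {up : ∀ i : ℤ, V i →ₗ[k] V (i + 1)}
    (down : ∀ i : ℤ, V (i + 1) →ₗ[k] V i) (h : ∀ j, up j = 0) {i j : ℤ} (hij : i < j) :
    transfer up down i j = 0 := by
  obtain ⟨n, hn⟩ : ∃ n, (j - i).toNat = n + 1 := ⟨(j - i).toNat - 1, by omega⟩
  have hpow : upPow up (j - i).toNat i = 0 := by
    rw [hn, upPow, h, zero_comp, comp_zero]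
  rw [transfer, dif_pos hij.le, hpow, comp_zero]

theorem transfer_eq_zero_of_down_eq_zero (up : ∀ i : ℤ, V i →ₗ[k] V (i + 1))
    {down : ∀ i : ℤ, V (i + 1) →ₗ[k] V i} (h : ∀ j, down j = 0) {i j : ℤ} (hij : j < i) :
    transfer up down i j = 0 := by
  obtain ⟨n, hn⟩ : ∃ n, (i - j).toNat = n + 1 := ⟨(i - j).toNat - 1, by omega⟩
  have hpow : downPow down (i - j).toNat j = 0 := by
    rw [hn, downPow, h, zero_comp, comp_zero]
  rw [transfer, dif_neg (by omega), hpow, zero_comp]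

theorem transfer_injective {up : ∀ i : ℤ, V i →ₗ[k] V (i + 1)}
    {down : ∀ i : ℤ, V (i + 1) →ₗ[k] V i} {i : ℤ} (hup : ∀ j, j < i → Function.Injective (up j))
    (hdown : ∀ j, i ≤ j → Function.Injective (down j)) (j : ℤ) :
    Function.Injective (transfer up down j i) := by
  unfold transfer
  split_ifs with h
  · exact (castMap_injective _).comp (upPow_injective _ _ fun m hm => hup m (by omega))
  · exact (downPow_injective _ _ hdown).comp (castMap_injective _)

/-- A finite cosupport excludes that all upward maps vanish. -/
theorem exists_up_ne_zero [∀ i, Nontrivial (V i)] {up : ∀ i : ℤ, V i →ₗ[k] V (i + 1)}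
    {down : ∀ i : ℤ, V (i + 1) →ₗ[k] V i} {H : Finset ℤ} (hH : RepCosupport up down ↑H) :
    ∃ i, up i ≠ 0 := by
  by_contra! h
  obtain ⟨b, hb⟩ := H.bddBelow
  obtain ⟨j, hj, hinj⟩ := hH (b - 1)
  have hbj : b ≤ j := hb hj
  rw [transfer_eq_zero_of_up_eq_zero down h (by omega)] at hinj
  obtain ⟨x, hx⟩ := exists_ne (0 : V (b - 1))
  exact hx (hinj (by simp))

/-- A finite cosupport excludes that all downward maps vanish. -/
theorem exists_down_ne_zero [∀ i, Nontrivial (V i)] {up : ∀ i : ℤ, V i →ₗ[k] V (i + 1)}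
    {down : ∀ i : ℤ, V (i + 1) →ₗ[k] V i} {H : Finset ℤ} (hH : RepCosupport up down ↑H) :
    ∃ i, down i ≠ 0 := by
  by_contra! h
  obtain ⟨b, hb⟩ := H.bddAbove
  obtain ⟨j, hj, hinj⟩ := hH (b + 1)
  have hbj : j ≤ b := hb hj
  rw [transfer_eq_zero_of_down_eq_zero up h (by omega)] at hinj
  obtain ⟨x, hx⟩ := exists_ne (0 : V (b + 1))
  exact hx (hinj (by simp))

/-- An upward closed predicate on the integers that is neither always false nor always true
holds exactly from some integer on. -/
theorem exists_forall_iff_le_of_succ {P : ℤ → Prop} (hP : ∀ i, P i → P (i + 1))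
    (h : ∃ i, P i) (h' : ∃ i, ¬ P i) : ∃ i, ∀ j, P j ↔ i ≤ j := by
  have hmono : ∀ i j, i ≤ j → P i → P j := fun i j hij hi =>
    Int.leInduction hi (fun n _ => hP n) j hij
  obtain ⟨b, hb⟩ := h'
  obtain ⟨i, hi, hmin⟩ := Int.exists_least_of_bdd
    ⟨b, fun z hz => le_of_not_ge fun hzb => hb (hmono z b hzb hz)⟩ h
  exact ⟨i, fun j => ⟨hmin j, fun hij => hmono i j hij hi⟩⟩

/-- A representation of pure dimension 1 is an exact colinked chain with
finite cosupport if and only if there is a vertex `i` with `(a^j, a_j) = (1,0)` for `j < i`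
and `(a^j, a_j) = (0,1)` for `j ≥ i` (where `a^j = 0` iff `w^j = 0` and `a_j = 0` iff
`w_j = 0`). -/
theorem pure_one_exact_colinkedChain_finite_cosupport_iff
    (W : ℤ → Type v) [∀ i, AddCommGroup (W i)] [∀ i, Module k (W i)]
    [∀ i, FiniteDimensional k (W i)]
    (up : ∀ i : ℤ, W i →ₗ[k] W (i + 1)) (down : ∀ i : ℤ, W (i + 1) →ₗ[k] W i)
    (hpure : ∀ i : ℤ, Module.finrank k (W i) = 1) :
    (ExactRep up down ∧ ColinkedChain up down ∧ ∃ H : Finset ℤ, RepCosupport up down ↑H) ↔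
      ∃ i : ℤ, (∀ j : ℤ, j < i → up j ≠ 0 ∧ down j = 0) ∧
        (∀ j : ℤ, i ≤ j → up j = 0 ∧ down j ≠ 0) := by
  have hsimple : ∀ i, IsSimpleModule k (W i) :=
    fun i => isSimpleModule_iff_finrank_eq_one.mpr (hpure i)
  have hnontriv : ∀ i, Nontrivial (W i) := fun i => IsSimpleModule.nontrivial k (W i)
  have hupbij : ∀ i, up i ≠ 0 → Function.Bijective (up i) :=
    fun i => (up i).bijective_or_eq_zero.resolve_right
  have hdownbij : ∀ i, down i ≠ 0 → Function.Bijective (down i) :=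
    fun i => (down i).bijective_or_eq_zero.resolve_right
  constructor
  · rintro ⟨hexact, ⟨-, hcolinked⟩, H, hH⟩
    have hiff : ∀ i, up i = 0 ↔ down i ≠ 0 := by
      refine fun i => ⟨fun hu hd => ?_, fun hd => ?_⟩
      · have := (hexact i).1
        rw [hu, hd, ker_zero, range_zero] at this
        exact top_ne_bot this
      · rw [← ker_eq_top, (hexact i).1]
        exact range_eq_top.mpr (hdownbij i hd).2
    have hsucc : ∀ i, up i = 0 → up (i + 1) = 0 := by
      refine fun i hu => (hiff _).mpr fun hd => ?_
      have := hcolinked i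
      rw [hu, hd, range_zero, range_zero, sup_idem] at this
      exact bot_ne_top this
    obtain ⟨i, hi⟩ := exists_forall_iff_le_of_succ hsucc
      ((exists_down_ne_zero hH).imp fun i => (hiff i).mpr) (exists_up_ne_zero hH)
    refine ⟨i, fun j hj => ?_, fun j hj => ?_⟩
    · have hu : up j ≠ 0 := fun h => hj.not_ge ((hi j).mp h)
      exact ⟨hu, not_not.mp fun hd => hu ((hiff j).mpr hd)⟩
    · have hu := (hi j).mpr hj
      exact ⟨hu, (hiff j).mp hu⟩
  · rintro ⟨i, hlt, hge⟩
    refine ⟨fun j => ?_, ⟨fun j => ?_, fun j => ?_⟩, {i}, fun j => ⟨i, by simp, ?_⟩⟩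
    · rcases lt_or_ge j i with hj | hj
      · obtain ⟨hu, hd⟩ := hlt j hj
        rw [hd, ker_zero, range_zero]
        exact ⟨ker_eq_bot.mpr (hupbij j hu).1, (range_eq_top.mpr (hupbij j hu).2).symm⟩
      · obtain ⟨hu, hd⟩ := hge j hj
        rw [hu, ker_zero, range_zero]
        exact ⟨(range_eq_top.mpr (hdownbij j hd).2).symm, ker_eq_bot.mpr (hdownbij j hd).1⟩
    · rcases lt_or_ge j i with hj | hj
      · simp [(hlt j hj).2]
      · simp [(hge j hj).1]
    · rcases lt_or_ge j i with hj | hj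
      · rw [range_eq_top.mpr (hupbij j (hlt j hj).1).2, sup_top_eq]
      · rw [range_eq_top.mpr (hdownbij _ (hge (j + 1) (by omega)).2).2, top_sup_eq]
    · exact transfer_injective (fun m hm => (hupbij m (hlt m hm).1).1)
        (fun m hm => (hdownbij m (hge m hm).2).1) j

end ZChain
end

section
/- Let 𝔲 be a pure linked chain of dimension r over a field k with finite support, and let a be an exact function assigning a^i, a_i ∈ {0,1} to each i ∈ ℤ. If there exists a pure dimension-1 subrepresentation 𝔴 of 𝔲 with a^i(𝔴) = a^i and a_i(𝔴) = a_i for all i ∈ ℤ, then there exists i ∈ ℤ such that (a^j, a_j) = (0,1) for every j < i and (a^j, a_j) = (1,0) for every j ≥ i. -/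
open LinearMap Submodule Module

namespace ZChain

universe u v

variable {k : Type u} [Field k]

variable {V : ℤ → Type v} [∀ i, AddCommGroup (V i)] [∀ i, Module k (V i)]

theorem range_castMap_comp_down_le (down : ∀ i : ℤ, V (i + 1) →ₗ[k] V i) {i j l : ℤ}
    (h : i = j) (h' : l = i + 1) :
    range (castMap h ∘ₗ down i ∘ₗ castMap h') ≤ range (down j) := by
  subst h
  subst h'
  exact le_rfl

theorem range_castMap_comp_up_le (up : ∀ i : ℤ, V i →ₗ[k] V (i + 1)) {i j : ℤ}
    (h : i = j) (h' : i + 1 = j + 1) :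
    range (castMap h' ∘ₗ up i) ≤ range (up j) := by
  subst h
  exact le_rfl

theorem castMap_comp_castMap {i j l : ℤ} (h : i = j) (h' : j = l) :
    castMap (k := k) (V := V) h' ∘ₗ castMap h = castMap (h.trans h') := by
  subst h
  subst h'
  rfl

theorem range_downPow_succ_le (down : ∀ i : ℤ, V (i + 1) →ₗ[k] V i) (n : ℕ) (i : ℤ) :
    range (downPow down (n + 1) i) ≤ range (down i) := by
  induction n with
  | zero => exact range_castMap_comp_down_le down _ _
  | succ n ih => exact (range_comp_le_range _ _).trans ih

theorem range_castMap_comp_upPow_le (up : ∀ i : ℤ, V i →ₗ[k] V (i + 1)) {N : ℕ} (hN : N ≠ 0)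
    {i m : ℤ} (h : i + (N : ℤ) = m + 1) :
    range (castMap h ∘ₗ upPow up N i) ≤ range (up m) := by
  obtain ⟨n, rfl⟩ := Nat.exists_eq_succ_of_ne_zero hN
  have hm : i + n = m := by push_cast at h; omega
  rw [upPow, ← comp_assoc, castMap_comp_castMap, ← comp_assoc]
  exact (range_comp_le_range _ _).trans (range_castMap_comp_up_le up hm _)

theorem range_transfer_le_range_up (up : ∀ i : ℤ, V i →ₗ[k] V (i + 1))
    (down : ∀ i : ℤ, V (i + 1) →ₗ[k] V i) {j m : ℤ} (hj : j ≤ m) :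
    range (transfer up down j (m + 1)) ≤ range (up m) := by
  rw [transfer, dif_pos (by omega)]
  exact range_castMap_comp_upPow_le up (by omega) _

theorem range_transfer_le_range_down (up : ∀ i : ℤ, V i →ₗ[k] V (i + 1))
    (down : ∀ i : ℤ, V (i + 1) →ₗ[k] V i) {i j : ℤ} (hj : i < j) :
    range (transfer up down j i) ≤ range (down i) := by
  rw [transfer, dif_neg (by omega)]
  refine (range_comp_le_range _ _).trans ?_
  obtain ⟨n, hn⟩ : ∃ n : ℕ, (j - i).toNat = n + 1 := ⟨(j - i - 1).toNat, by omega⟩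
  rw [hn]
  exact range_downPow_succ_le down n i

/-- Above every element of a support, the downward maps of a special chain vanish. -/
theorem SpecialChain.down_eq_zero {up : ∀ i : ℤ, V i →ₗ[k] V (i + 1)}
    {down : ∀ i : ℤ, V (i + 1) →ₗ[k] V i} (hs : SpecialChain up down) {H : Set ℤ}
    (hH : RepSupport up down H) {m : ℤ} (hm : ∀ j ∈ H, j ≤ m) : down m = 0 := by
  obtain ⟨j, hj, hsurj⟩ := hH (m + 1)
  have htop : range (up m) = ⊤ :=
    top_le_iff.mp ((range_eq_top.mpr hsurj).ge.trans (range_transfer_le_range_up up down (hm j hj)))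
  exact (cancel_right (range_eq_top.mp htop)).mp ((hs m).1.trans (zero_comp _).symm)

/-- Below every element of a support, the upward maps of a special chain vanish. -/
theorem SpecialChain.up_eq_zero {up : ∀ i : ℤ, V i →ₗ[k] V (i + 1)}
    {down : ∀ i : ℤ, V (i + 1) →ₗ[k] V i} (hs : SpecialChain up down) {H : Set ℤ}
    (hH : RepSupport up down H) {m : ℤ} (hm : ∀ j ∈ H, m < j) : up m = 0 := by
  obtain ⟨j, hj, hsurj⟩ := hH m
  have htop : range (down m) = ⊤ :=
    top_le_iff.mp
      ((range_eq_top.mpr hsurj).ge.trans (range_transfer_le_range_down up down (hm j hj)))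
  exact (cancel_right (range_eq_top.mp htop)).mp ((hs m).2.trans (zero_comp _).symm)

/-- Let `𝔲` be a pure linked chain of dimension `r` with finite support and
`a` an exact function on the arrows (encoded by `au ad : ℤ → Bool`, `a^i = 1` iff
`au i = true`, `a_i = 1` iff `ad i = true`; exactness means exactly one of `au i`, `ad i`
is `true`).  If some pure dimension-1 subrepresentation has profile `a`, then there is
`i ∈ ℤ` with `(a^j, a_j) = (0,1)` for `j < i` and `(a^j, a_j) = (1,0)` for `j ≥ i`. -/
theorem profile_of_subrep_of_linkedChain
    (V : ℤ → Type v) [∀ i, AddCommGroup (V i)] [∀ i, Module k (V i)]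
    [∀ i, FiniteDimensional k (V i)]
    (up : ∀ i : ℤ, V i →ₗ[k] V (i + 1)) (down : ∀ i : ℤ, V (i + 1) →ₗ[k] V i)
    (r : ℕ) (hpure : ∀ i : ℤ, Module.finrank k (V i) = r)
    (hlc : LinkedChain up down)
    (hfs : ∃ H : Finset ℤ, RepSupport up down ↑H)
    (au ad : ℤ → Bool) (hexa : ∀ i : ℤ, au i ≠ ad i)
    (hW : ∃ W : ∀ i : ℤ, Submodule k (V i),
      IsSubrep up down W ∧ (∀ i : ℤ, Module.finrank k (W i) = 1) ∧
      (∀ i : ℤ, au i = true ↔ (W i).map (up i) ≠ ⊥) ∧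
      (∀ i : ℤ, ad i = true ↔ (W (i + 1)).map (down i) ≠ ⊥)) :
    ∃ i : ℤ, (∀ j : ℤ, j < i → au j = false ∧ ad j = true) ∧
      (∀ j : ℤ, i ≤ j → au j = true ∧ ad j = false) := by
  obtain ⟨hs, hker⟩ := hlc
  obtain ⟨H, hH⟩ := hfs
  obtain ⟨W, -, hW1, hau, had⟩ := hW
  have had_eq : ∀ i, ad i = !au i := fun i => by
    have := hexa i
    cases h : au i <;> cases h' : ad i <;> simp_all
  have hstep : ∀ i, au i = true → au (i + 1) = true := by
    intro i hi
    rw [hau]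
    intro hup
    have hdown : (W (i + 1)).map (down i) = ⊥ := by
      by_contra hne
      have := (had i).mpr hne
      simp [had_eq, hi] at this
    have hbot : W (i + 1) = ⊥ := by
      rw [eq_bot_iff, ← hker i]
      exact le_inf ((le_ker_iff_map).mpr hdown) ((le_ker_iff_map).mpr hup)
    have := hW1 (i + 1)
    rw [hbot, finrank_bot] at this
    exact zero_ne_one this
  have hmono : ∀ i j, i ≤ j → au i = true → au j = true := fun i j hij hi =>
    Int.leInduction hi (fun n _ hn => hstep n hn) j hij
  obtain ⟨M, hM⟩ := H.bddAbove
  obtain ⟨m, hm⟩ := H.bddBelow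
  have htrue : au M = true := by
    have : ¬ ad M = true := by
      rw [had, hs.down_eq_zero hH fun j hj => hM hj]
      simp
    simpa [had_eq] using this
  have hfalse : ¬ au (m - 1) = true := by
    rw [hau, hs.up_eq_zero hH fun j hj => by have := hm hj; omega]
    simp
  obtain ⟨i, hi, hleast⟩ := Int.exists_least_of_bdd (P := fun i => au i = true)
    ⟨m, fun z hz => by
      by_contra hlt
      exact hfalse (hmono z (m - 1) (by omega) hz)⟩ ⟨M, htrue⟩
  refine ⟨i, fun j hj => ?_, fun j hj => ?_⟩
  · have : au j = false := by
      by_contra h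
      have := hleast j (by simpa using h)
      omega
    simp [had_eq, this]
  · simp [had_eq, hmono i j hj hi]

end ZChain
end

section
/- Let 𝔳 = (V_i, v_i, v^i) be an exact colinked chain of dimension r over a field k with finite cosupport, and for each i ∈ ℤ set r_i := dim(Im(v^{i-1}) ∩ Im(v_i)). Let a be an exact function assigning a^i, a_i ∈ {0,1} to each i ∈ ℤ such that a^j = 1 for all sufficiently small j and a_j = 1 for all sufficiently large j. Then there exists a pure dimension-1 subrepresentation 𝔴 of 𝔳 with a^i(𝔴) = a^i and a_i(𝔴) = a_i for all i ∈ ℤ if and only if every sink i of a satisfies r_i > 0. -/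
open LinearMap Submodule Module

namespace ZChain

universe u v

variable {k : Type u} [Field k]

variable {V : ℤ → Type v} [∀ i, AddCommGroup (V i)] [∀ i, Module k (V i)]

/-- Solve a recursion `a i = f i (a (i + 1))` on `ℤ` that starts afresh at all large indices. -/
lemma exists_backward_rec {X : ℤ → Type*} (p : ℤ → Bool) (f : ∀ i, X (i + 1) → X i)
    (c : ∀ i, X i) (N : ℤ) (hN : ∀ j, N < j → p j = false) :
    ∃ a : ∀ i, X i, ∀ i, a i = if p i = true then f i (a (i + 1)) else c i := by
  let F : ∀ n : ℕ, ∀ i : ℤ, X i := fun n => n.rec c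
    (fun _ prev i => if p i = true then f i (prev (i + 1)) else c i)
  have hF : ∀ n i, F (n + 1) i = if p i = true then f i (F n (i + 1)) else c i :=
    fun _ _ => rfl
  refine ⟨fun i => F ((N + 1 - i).toNat) i, fun i => ?_⟩
  dsimp only
  by_cases hi : p i = true
  · have hle : i ≤ N := by
      by_contra h
      exact absurd (hN i (by omega)) (by simp [hi])
    have e : (N + 1 - i).toNat = (N + 1 - (i + 1)).toNat + 1 := by omega
    rw [e, hF]
  · rw [if_neg hi]
    cases (N + 1 - i).toNat with
    | zero => rfl
    | succ n => rw [hF, if_neg hi]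

/-- Solve a recursion `b (i + 1) = f i (b i)` on `ℤ` that starts afresh at all small indices. -/
lemma exists_forward_rec {X : ℤ → Type*} (p : ℤ → Bool) (f : ∀ i, X i → X (i + 1))
    (c : ∀ i, X i) (N : ℤ) (hN : ∀ j, j < N → p j = false) :
    ∃ b : ∀ i, X i, ∀ i, b (i + 1) = if p i = true then f i (b i) else c (i + 1) := by
  let g : ∀ i j : ℤ, i + 1 = j → X i → X j := fun i j h x => h ▸ f i x
  let F : ∀ n : ℕ, ∀ i : ℤ, X i := fun n => n.rec c
    (fun _ prev i => if p (i - 1) = true then g (i - 1) i (by omega) (prev (i - 1)) else c i)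
  have hF : ∀ n i, F (n + 1) (i + 1) = if p i = true then f i (F n i) else c (i + 1) := by
    intro n i
    change (if p (i + 1 - 1) = true then
      g (i + 1 - 1) (i + 1) (by omega) (F n (i + 1 - 1)) else c (i + 1)) = _
    have key : ∀ j (h : j = i), (if p j = true then g j (i + 1) (by omega) (F n j)
        else c (i + 1)) = if p i = true then f i (F n i) else c (i + 1) := by
      rintro j rfl
      rfl
    exact key _ (by omega)
  refine ⟨fun i => F ((i - N).toNat) i, fun i => ?_⟩
  dsimp only
  by_cases hi : p i = true
  · have hle : N ≤ i := by
      by_contra h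
      exact absurd (hN i (by omega)) (by simp [hi])
    have e : (i + 1 - N).toNat = (i - N).toNat + 1 := by omega
    rw [e, hF]
  · rw [if_neg hi]
    cases (i + 1 - N).toNat with
    | zero => rfl
    | succ n => rw [hF, if_neg hi]

/-- The images of the upward maps, indexed by the vertex they arrive at. -/
lemma exists_range_up (up : ∀ i : ℤ, V i →ₗ[k] V (i + 1)) :
    ∃ A : ∀ i : ℤ, Submodule k (V i), ∀ i, A (i + 1) = range (up i) := by
  refine ⟨fun i => (range (up (i - 1))).map (castMap (by omega)), fun i => ?_⟩
  have key : ∀ j (h : j = i), (range (up j)).map (castMap (by omega)) = range (up i) := by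
    rintro j rfl
    exact Submodule.map_id _
  exact key _ (by omega)

/-- A colinked chain has a compatible family of nonzero vectors along any exact orientation that
points to the right far left and to the left far right, and whose sinks have nonzero
intersection of incoming images. -/
lemma exists_vectors_of_sinks (up : ∀ i : ℤ, V i →ₗ[k] V (i + 1))
    (down : ∀ i : ℤ, V (i + 1) →ₗ[k] V i) (hcc : ColinkedChain up down) (p : ℤ → Bool)
    (hsmall : ∃ N : ℤ, ∀ j : ℤ, j < N → p j = true)
    (hlarge : ∃ N : ℤ, ∀ j : ℤ, N < j → p j = false)
    (hsink : ∀ i : ℤ, p i = true → p (i + 1) = false →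
      range (up i) ⊓ range (down (i + 1)) ≠ ⊥) :
    ∃ w : ∀ i, V i, (∀ i, w i ≠ 0) ∧ (∀ i, p i = true → up i (w i) = w (i + 1)) ∧
      (∀ i, p i = false → down i (w (i + 1)) = w i) := by
  obtain ⟨hsp, hsup⟩ := hcc
  have hdu : ∀ i x, down i (up i x) = 0 := fun i x => LinearMap.congr_fun (hsp i).1 x
  have hud : ∀ i x, up i (down i x) = 0 := fun i x => LinearMap.congr_fun (hsp i).2 x
  obtain ⟨A, hA⟩ := exists_range_up up
  have hsucc : ∀ i : ℤ, ∃ j, i = j + 1 := fun i => ⟨i - 1, by omega⟩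
  have hAB : ∀ i, A i ⊔ range (down i) = ⊤ := by
    intro i
    obtain ⟨j, rfl⟩ := hsucc i
    rw [hA, sup_comm, hsup]
  have hf : ∀ i (y : A (i + 1)), ∃ x : A i, up i x = y := by
    rintro i ⟨y, hy⟩
    rw [hA] at hy
    obtain ⟨x, rfl⟩ := hy
    have hx : x ∈ A i ⊔ range (down i) := by rw [hAB]; trivial
    obtain ⟨x₁, h₁, _, ⟨z, rfl⟩, rfl⟩ := Submodule.mem_sup.1 hx
    exact ⟨⟨x₁, h₁⟩, by simp [hud]⟩
  have hg : ∀ i (y : range (down i)), ∃ x : range (down (i + 1)), down i x = y := by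
    rintro i ⟨_, x, rfl⟩
    have hx : x ∈ range (down (i + 1)) ⊔ range (up i) := by rw [hsup]; trivial
    obtain ⟨x₁, h₁, _, ⟨z, rfl⟩, rfl⟩ := Submodule.mem_sup.1 hx
    exact ⟨⟨x₁, h₁⟩, by simp [hdu]⟩
  have hc : ∀ i, ∃ c : V i, c ∈ A i ∧ c ∈ range (down i) ∧
      (p (i - 1) = true → p i = false → c ≠ 0) ∧ (¬ (p (i - 1) = true ∧ p i = false) → c = 0) := by
    intro i
    by_cases h : p (i - 1) = true ∧ p i = false
    · obtain ⟨j, rfl⟩ := hsucc i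
      rw [add_sub_cancel_right] at h ⊢
      obtain ⟨c, ⟨h₁, h₂⟩, h₃⟩ := Submodule.exists_mem_ne_zero_of_ne_bot (hsink j h.1 h.2)
      exact ⟨c, by rwa [hA], h₂, fun _ _ => h₃, fun h' => absurd h h'⟩
    · exact ⟨0, zero_mem _, zero_mem _, fun h₁ h₂ => absurd ⟨h₁, h₂⟩ h, fun _ => rfl⟩
  choose f hf using hf
  choose g hg using hg
  choose c hcA hcB hc₁ hc₀ using hc
  obtain ⟨M, hM⟩ := hsmall
  obtain ⟨N, hN⟩ := hlarge
  obtain ⟨a, ha⟩ := exists_backward_rec (X := fun i => A i) p f (fun i => ⟨c i, hcA i⟩) N hN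
  obtain ⟨b, hb⟩ := exists_forward_rec (X := fun i => range (down i)) (fun i => !p i) g
    (fun i => ⟨c i, hcB i⟩) M (fun j hj => by simp [hM j hj])
  have hup_b : ∀ i, up i (b i) = 0 := by
    intro i
    obtain ⟨z, hz⟩ := (b i).2
    rw [← hz, hud]
  have hdown_a : ∀ i, down i (a (i + 1)) = 0 := by
    intro i
    obtain ⟨z, hz⟩ := (hA i).le (a (i + 1)).2
    rw [← hz, hdu]
  have ha_up : ∀ i, p i = true → up i (a i) = a (i + 1) := by
    intro i hi
    rw [ha i, if_pos hi, hf]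
  have ha_c : ∀ i, p i = false → (a i : V i) = c i := by
    intro i hi
    rw [ha i, if_neg (by simp [hi])]
  have hb_down : ∀ i, p i = false → down i (b (i + 1)) = b i := by
    intro i hi
    rw [hb i, if_pos (by simp [hi]), hg]
  have hb_c : ∀ i, p i = true → (b (i + 1) : V (i + 1)) = c (i + 1) := by
    intro i hi
    rw [hb i, if_neg (by simp [hi])]
  let w : ∀ i, V i := fun i => if p i = true then (a i : V i) + b i else b i
  have hw₁ : ∀ i, p i = true → w i = (a i : V i) + b i := fun i hi => if_pos hi
  have hw₀ : ∀ i, p i = false → w i = b i := fun i hi => if_neg (by simp [hi])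
  have hw_up : ∀ i, p i = true → up i (w i) = w (i + 1) := by
    intro i hi
    rw [hw₁ i hi, map_add, hup_b, add_zero, ha_up i hi]
    cases h : p (i + 1) with
    | true => rw [hw₁ _ h, hb_c i hi, hc₀ (i + 1) (by simp [h]), add_zero]
    | false => rw [hw₀ _ h, hb_c i hi, ha_c _ h]
  have hw_down : ∀ i, p i = false → down i (w (i + 1)) = w i := by
    intro i hi
    have h' : down i (w (i + 1)) = down i (b (i + 1)) := by
      cases h : p (i + 1) with
      | true => rw [hw₁ _ h, map_add, hdown_a, zero_add]
      | false => rw [hw₀ _ h]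
    rw [h', hb_down i hi, hw₀ i hi]
  have hw_sink : ∀ i, p i = true → p (i + 1) = false → w (i + 1) ≠ 0 := by
    intro i hi hi'
    rw [hw₀ _ hi', hb_c i hi]
    exact hc₁ (i + 1) (by simpa using hi) hi'
  have hne_up : ∀ n : ℕ, ∀ i, (N + 1 - i).toNat = n → p i = true → w i ≠ 0 := by
    intro n
    induction n with
    | zero =>
      intro i hn hi
      exact absurd (hN i (by omega)) (by simp [hi])
    | succ n ih =>
      intro i hn hi h0
      have h1 := hw_up i hi
      rw [h0, map_zero] at h1
      cases h : p (i + 1) with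
      | true => exact ih (i + 1) (by omega) h h1.symm
      | false => exact hw_sink i hi h h1.symm
  have hne_down : ∀ n : ℕ, ∀ i, (i + 1 - M).toNat = n → p i = false → w i ≠ 0 := by
    intro n
    induction n with
    | zero =>
      intro i hn hi
      exact absurd (hM i (by omega)) (by simp [hi])
    | succ n ih =>
      intro i hn hi h0
      obtain ⟨j, rfl⟩ := hsucc i
      cases h : p j with
      | true => exact hw_sink j h hi h0
      | false =>
        have h1 := hw_down j h
        rw [h0, map_zero] at h1
        exact ih j (by omega) h h1.symm
  refine ⟨w, fun i => ?_, hw_up, hw_down⟩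
  cases h : p i with
  | true => exact hne_up _ i rfl h
  | false => exact hne_down _ i rfl h

/-- A nonzero linear image of a line is the whole target line. -/
lemma map_eq_of_finrank_eq_one {E F : Type*} [AddCommGroup E] [Module k E] [AddCommGroup F]
    [Module k F] (f : E →ₗ[k] F) {L : Submodule k E} {L' : Submodule k F}
    (hL' : finrank k L' = 1) (hle : L.map f ≤ L') (hne : L.map f ≠ ⊥) : L.map f = L' := by
  obtain ⟨y, hy, hy0⟩ := Submodule.exists_mem_ne_zero_of_ne_bot hne
  refine le_antisymm hle fun z hz => ?_
  obtain ⟨t, ht⟩ := (finrank_eq_one_iff_of_nonzero' (⟨y, hle hy⟩ : L')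
    (by simpa using hy0)).1 hL' ⟨z, hz⟩
  have ht' : t • y = z := congrArg Subtype.val ht
  exact ht' ▸ Submodule.smul_mem _ t hy

/-- Let `𝔳` be an exact colinked chain of dimension `r` with finite
cosupport, and set `r_i = dim (Im v^{i-1} ⊓ Im v_i)`.  Let `a` be an exact function on the
arrows (encoded by `au ad : ℤ → Bool`) with `a^j = 1` for all sufficiently small `j` and
`a_j = 1` for all sufficiently large `j`.  Then there exists a pure dimension-1
subrepresentation with profile `a` if and only if every sink `i` of `a` satisfies
`r_i > 0` (a sink at vertex `i + 1` means `au i = true` and `ad (i+1) = true`). -/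
theorem exists_subrep_profile_iff_sinks
    (V : ℤ → Type v) [∀ i, AddCommGroup (V i)] [∀ i, Module k (V i)]
    [∀ i, FiniteDimensional k (V i)]
    (up : ∀ i : ℤ, V i →ₗ[k] V (i + 1)) (down : ∀ i : ℤ, V (i + 1) →ₗ[k] V i)
    (hex : ExactRep up down) (hcc : ColinkedChain up down)
    (r : ℕ) (hpure : ∀ i : ℤ, Module.finrank k (V i) = r)
    (hfc : ∃ H : Finset ℤ, RepCosupport up down ↑H)
    (au ad : ℤ → Bool) (hexa : ∀ i : ℤ, au i ≠ ad i)
    (hsmall : ∃ N : ℤ, ∀ j : ℤ, j < N → au j = true)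
    (hlarge : ∃ N : ℤ, ∀ j : ℤ, N < j → ad j = true) :
    (∃ W : ∀ i : ℤ, Submodule k (V i),
      IsSubrep up down W ∧ (∀ i : ℤ, Module.finrank k (W i) = 1) ∧
      (∀ i : ℤ, au i = true ↔ (W i).map (up i) ≠ ⊥) ∧
      (∀ i : ℤ, ad i = true ↔ (W (i + 1)).map (down i) ≠ ⊥)) ↔
    (∀ i : ℤ, au i = true → ad (i + 1) = true →
      0 < Module.finrank k ↥(LinearMap.range (up i) ⊓ LinearMap.range (down (i + 1)))) := by
  constructor
  · rintro ⟨W, hW, hdim, hu, hd⟩ i hi hi'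
    have h₁ := map_eq_of_finrank_eq_one (up i) (hdim (i + 1))
      (Submodule.map_le_iff_le_comap.2 (hW i).1) ((hu i).1 hi)
    have h₂ := map_eq_of_finrank_eq_one (down (i + 1)) (hdim (i + 1))
      (Submodule.map_le_iff_le_comap.2 (hW (i + 1)).2) ((hd (i + 1)).1 hi')
    have hle : W (i + 1) ≤ range (up i) ⊓ range (down (i + 1)) :=
      le_inf (h₁ ▸ LinearMap.map_le_range) (h₂ ▸ LinearMap.map_le_range)
    have := Submodule.finrank_mono hle
    rw [hdim] at this
    omega
  · intro hsink
    have had : ∀ i, ad i = !au i := by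
      intro i
      have := hexa i
      cases h₁ : au i <;> cases h₂ : ad i <;> simp_all
    obtain ⟨N, hN⟩ := hlarge
    obtain ⟨w, hne, hwu, hwd⟩ := exists_vectors_of_sinks up down hcc au hsmall
      ⟨N, fun j hj => by simpa [had] using hN j hj⟩ (fun i hi hi' h0 => by
        have := hsink i hi (by simp [had, hi'])
        rw [h0, finrank_bot] at this
        exact lt_irrefl _ this)
    have hwu' : ∀ i, au i = false → up i (w i) = 0 := by
      intro i hi
      rw [← hwd i hi]
      exact LinearMap.congr_fun (hcc.1 i).2 _
    have hwd' : ∀ i, au i = true → down i (w (i + 1)) = 0 := by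
      intro i hi
      rw [← hwu i hi]
      exact LinearMap.congr_fun (hcc.1 i).1 _
    refine ⟨fun i => k ∙ w i, fun i => ⟨?_, ?_⟩, fun i => finrank_span_singleton (hne i),
      fun i => ?_, fun i => ?_⟩
    · change (k ∙ w i) ≤ (k ∙ w (i + 1)).comap (up i)
      rw [Submodule.span_singleton_le_iff_mem, Submodule.mem_comap]
      cases h : au i with
      | true => rw [hwu i h]; exact Submodule.mem_span_singleton_self _
      | false => rw [hwu' i h]; exact zero_mem _
    · change (k ∙ w (i + 1)) ≤ (k ∙ w i).comap (down i)
      rw [Submodule.span_singleton_le_iff_mem, Submodule.mem_comap]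
      cases h : au i with
      | true => rw [hwd' i h]; exact zero_mem _
      | false => rw [hwd i h]; exact Submodule.mem_span_singleton_self _
    · rw [Submodule.map_span, Set.image_singleton, Ne, Submodule.span_singleton_eq_bot]
      cases h : au i with
      | true => simpa [hwu i h] using hne (i + 1)
      | false => simp [hwu' i h]
    · rw [Submodule.map_span, Set.image_singleton, Ne, Submodule.span_singleton_eq_bot, had]
      cases h : au i with
      | true => simp [hwd' i h]
      | false => simpa [hwd i h] using hne i

end ZChain
end

section
/- Let 𝔳 = (V_i, v_i, v^i) be an exact colinked chain over a field k with finite cosupport, let 𝔴 = (W_l) be a pure dimension-1 subrepresentation of 𝔳, and let x_l ∈ W_l be a nonzero vector for each l ∈ ℤ. Let i ∈ ℤ be a vertex with v^i(W_i) = 0 and v_i(W_{i+1}) = 0. Then there exist vectors y_l ∈ V_l for l ∈ ℤ and a finite subset S ⊆ k such that for every t ∈ k ∖ S: x_l + t·y_l ≠ 0 for all l ∈ ℤ, the spans W_l(t) := span(x_l + t·y_l) form a pure dimension-1 subrepresentation 𝔴(t) of 𝔳, v^i(W_i(t)) ≠ 0, a^l(𝔴(t)) = a^l(𝔴) for every l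 ≠ i, and a_l(𝔴(t)) = a_l(𝔴) for every l ∈ ℤ. -/
open LinearMap Submodule Module

namespace ZChain

universe u v

variable {k : Type u} [Field k]

variable {V : ℤ → Type v} [∀ i, AddCommGroup (V i)] [∀ i, Module k (V i)]

/-- A vector of `V l` killed by the downward arrow leaving the vertex `l`. -/
def DownKilled (down : ∀ i : ℤ, V (i + 1) →ₗ[k] V i) (l : ℤ) (y : V l) : Prop :=
  ∀ (m : ℤ) (h : m + 1 = l), down m (h ▸ y) = 0

theorem exists_downKilled_preimage
    {up : ∀ i : ℤ, V i →ₗ[k] V (i + 1)} {down : ∀ i : ℤ, V (i + 1) →ₗ[k] V i}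
    (hex : ExactRep up down) (hcc : ColinkedChain up down) (l : ℤ) (w : V (l + 1))
    (hw : down l w = 0) : ∃ y : V l, DownKilled down l y ∧ up l y = w := by
  have hw' : w ∈ range (up l) := (hex l).2 ▸ LinearMap.mem_ker.2 hw
  obtain ⟨z, rfl⟩ := hw'
  obtain ⟨m, rfl⟩ : ∃ m : ℤ, l = m + 1 := ⟨l - 1, by ring⟩
  have hz : z ∈ range (down (m + 1)) ⊔ range (up m) := by
    rw [hcc.2 m]
    exact Submodule.mem_top
  obtain ⟨_, ⟨a, rfl⟩, _, ⟨b, rfl⟩, rfl⟩ := Submodule.mem_sup.1 hz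
  refine ⟨up m b, fun m' h => ?_, ?_⟩
  · obtain rfl : m' = m := by omega
    exact LinearMap.congr_fun (hcc.1 m').1 b
  · have h0 : up (m + 1) (down (m + 1) a) = 0 := LinearMap.congr_fun (hcc.1 (m + 1)).2 a
    rw [map_add, h0, zero_add]

/-- A vector killed by its downward arrow can be lifted along the upward arrows, with prescribed
multipliers, to all the vertices on its left, the lift being zero wherever the multiplier is. -/
theorem exists_downKilled_family
    {up : ∀ i : ℤ, V i →ₗ[k] V (i + 1)} {down : ∀ i : ℤ, V (i + 1) →ₗ[k] V i}
    (hex : ExactRep up down) (hcc : ColinkedChain up down) (c : ℤ → k) (i : ℤ) (y₀ : V i)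
    (hy₀ : DownKilled down i y₀) :
    ∃ y : ∀ l : ℤ, V l, y i = y₀ ∧ (∀ l, i < l → y l = 0) ∧
      (∀ l, down l (y (l + 1)) = 0) ∧
      ∀ l, l < i → up l (y l) = c l • y (l + 1) ∧ (c l = 0 → y l = 0) := by
  have step : ∀ (m l : ℤ) (h : m + 1 = l) (y' : V l), DownKilled down l y' →
      ∃ y : V m, DownKilled down m y ∧
        (∀ h : m + 1 = l, up m y = c m • (h ▸ y' : V (m + 1))) ∧ (c m = 0 → y = 0) := by
    rintro m _ rfl y' hy'
    by_cases hc : c m = 0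
    · refine ⟨0, ?_, by simp [hc], fun _ => rfl⟩
      rintro m' rfl
      exact map_zero _
    · have hy'' : down m y' = 0 := hy' m rfl
      obtain ⟨y, hy, hyu⟩ := exists_downKilled_preimage hex hcc m (c m • y')
        (by rw [map_smul, hy'', smul_zero])
      exact ⟨y, hy, fun _ => hyu, fun h => absurd h hc⟩
  have hzero : ∀ l, DownKilled down l (0 : V l) := by
    rintro _ m rfl
    exact map_zero _
  let g : ∀ l : ℤ, {y : V l // DownKilled down l y} := fun l =>
    Int.inductionOn' (motive := fun l => {y : V l // DownKilled down l y}) l i ⟨y₀, hy₀⟩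
      (fun l _ _ => ⟨0, hzero _⟩)
      (fun l _ y' => ⟨_, (step (l - 1) l (by ring) y'.1 y'.2).choose_spec.1⟩)
  refine ⟨fun l => (g l).1, ?_, ?_, fun l => (g (l + 1)).2 l rfl, ?_⟩
  · simp only [g, Int.inductionOn'_self]
  · intro l hl
    obtain ⟨m, rfl⟩ : ∃ m : ℤ, l = m + 1 := ⟨l - 1, by ring⟩
    simp only [g]
    rw [Int.inductionOn'_add_one (by omega)]
  · intro l hl
    obtain ⟨z, rfl⟩ : ∃ z : ℤ, l = z - 1 := ⟨l + 1, by ring⟩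
    have hg : g (z - 1) = ⟨_, (step (z - 1) z (by ring) (g z).1 (g z).2).choose_spec.1⟩ :=
      Int.inductionOn'_sub_one (by omega)
    have key := (step (z - 1) z (by ring) (g z).1 (g z).2).choose_spec.2
    have hg' := congrArg Subtype.val hg
    dsimp only at hg' ⊢
    rw [← hg'] at key
    refine ⟨?_, key.2⟩
    have cast_eq : ∀ z' (h : z' = z), (h ▸ (g z).1 : V z') = (g z').1 := by
      rintro _ rfl
      rfl
    rw [← cast_eq (z - 1 + 1) (by ring)]
    exact key.1 (by ring)

/-- Let `𝔳` be an exact colinked chain with finite cosupport, `𝔴 = (W l)` a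
pure dimension-1 subrepresentation with chosen nonzero generators `x l ∈ W l`, and `i` a
vertex with `v^i (W i) = 0` and `v_i (W (i+1)) = 0`.  Then there are vectors `y l ∈ V l` and
a finite set `S ⊆ k` such that for all `t ∉ S` the vectors `x l + t • y l` are nonzero, their
spans form a pure dimension-1 subrepresentation `𝔴(t)` of `𝔳`, `v^i (W i (t)) ≠ 0`, and
`𝔴(t)` has the same profile as `𝔴` at all arrows except `α^i`. -/
theorem deformation_of_subrep
    (V : ℤ → Type v) [∀ i, AddCommGroup (V i)] [∀ i, Module k (V i)]
    [∀ i, FiniteDimensional k (V i)]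
    (up : ∀ i : ℤ, V i →ₗ[k] V (i + 1)) (down : ∀ i : ℤ, V (i + 1) →ₗ[k] V i)
    (hex : ExactRep up down) (hcc : ColinkedChain up down)
    (hfc : ∃ H : Finset ℤ, RepCosupport up down ↑H)
    (W : ∀ i : ℤ, Submodule k (V i)) (hsub : IsSubrep up down W)
    (hW1 : ∀ i : ℤ, Module.finrank k (W i) = 1)
    (x : ∀ l : ℤ, V l) (hx : ∀ l : ℤ, x l ∈ W l) (hx0 : ∀ l : ℤ, x l ≠ 0)
    (i : ℤ) (hupz : (W i).map (up i) = ⊥) (hdownz : (W (i + 1)).map (down i) = ⊥) :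
    ∃ (y : ∀ l : ℤ, V l) (S : Finset k), ∀ t : k, t ∉ S →
      (∀ l : ℤ, x l + t • y l ≠ 0) ∧
      (∀ l : ℤ, (Submodule.span k {x l + t • y l}).map (up l) ≤
        Submodule.span k {x (l + 1) + t • y (l + 1)}) ∧
      (∀ l : ℤ, (Submodule.span k {x (l + 1) + t • y (l + 1)}).map (down l) ≤
        Submodule.span k {x l + t • y l}) ∧
      up i (x i + t • y i) ≠ 0 ∧
      (∀ l : ℤ, l ≠ i → (up l (x l + t • y l) = 0 ↔ up l (x l) = 0)) ∧
      (∀ l : ℤ, down l (x (l + 1) + t • y (l + 1)) = 0 ↔ down l (x (l + 1)) = 0) := by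
  have hgen : ∀ l, ∀ w ∈ W l, ∃ a : k, w = a • x l := by
    intro l w hw
    obtain ⟨a, ha⟩ := (finrank_eq_one_iff_of_nonzero' (⟨x l, hx l⟩ : W l)
      (by simpa [Subtype.ext_iff] using hx0 l)).1 (hW1 l) ⟨w, hw⟩
    exact ⟨a, (congrArg Subtype.val ha).symm⟩
  choose c hc using fun l => hgen (l + 1) (up l (x l)) ((hsub l).1 _ (hx l))
  choose d hd using fun l => hgen l (down l (x (l + 1))) ((hsub l).2 _ (hx (l + 1)))
  have hui : up i (x i) = 0 := (Submodule.eq_bot_iff _).1 hupz _ ⟨x i, hx i, rfl⟩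
  have hdi : down i (x (i + 1)) = 0 :=
    (Submodule.eq_bot_iff _).1 hdownz _ ⟨x (i + 1), hx (i + 1), rfl⟩
  obtain ⟨y₀, hy₀, hy₀u⟩ := exists_downKilled_preimage hex hcc i (x (i + 1)) hdi
  obtain ⟨y, rfl, hright, hdown, hleft⟩ := exists_downKilled_family hex hcc c i y₀ hy₀
  have hcd : ∀ l, d l • y l = 0 := by
    intro l
    rcases lt_trichotomy l i with h | rfl | h
    · have h0 : up l (down l (x (l + 1))) = 0 :=
        LinearMap.congr_fun (hcc.1 l).2 (x (l + 1))
      rw [hd, map_smul, hc, smul_eq_zero, smul_eq_zero] at h0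
      rcases h0 with h0 | h0 | h0
      · rw [h0, zero_smul]
      · rw [(hleft l h).2 h0, smul_zero]
      · exact absurd h0 (hx0 _)
    · rw [hd, smul_eq_zero] at hdi
      rw [hdi.resolve_right (hx0 _), zero_smul]
    · rw [hright l h, smul_zero]
  have hupt : ∀ l, l ≠ i → ∀ t : k,
      up l (x l + t • y l) = c l • (x (l + 1) + t • y (l + 1)) := by
    intro l hl t
    rw [map_add, map_smul, hc, smul_add, smul_comm (c l) t]
    rcases lt_or_gt_of_ne hl with h | h
    · rw [(hleft l h).1]
    · rw [hright l h, hright (l + 1) (by omega), map_zero, smul_zero, smul_zero, smul_zero]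
  have hupi : ∀ t : k, up i (x i + t • y i) = t • x (i + 1) := by
    intro t
    rw [map_add, map_smul, hui, hy₀u, zero_add]
  have hdownt : ∀ l, ∀ t : k, down l (x (l + 1) + t • y (l + 1)) = down l (x (l + 1)) := by
    intro l t
    rw [map_add, map_smul, hdown, smul_zero, add_zero]
  refine ⟨y, {0}, fun t ht => ?_⟩
  have ht0 : t ≠ 0 := by simpa using ht
  have hne : ∀ l, x l + t • y l ≠ 0 := by
    intro l
    induction l using Int.inductionOn' (b := i + 1) with
    | zero => rw [hright _ (by omega), smul_zero, add_zero]; exact hx0 _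
    | succ l hl _ => rw [hright _ (by omega), smul_zero, add_zero]; exact hx0 _
    | pred z hz ih =>
      obtain ⟨l, rfl⟩ : ∃ l : ℤ, z = l + 1 := ⟨z - 1, by ring⟩
      rw [add_sub_cancel_right]
      intro h0
      rcases eq_or_ne l i with rfl | hl
      · have h1 := hupi t
        rw [h0, map_zero] at h1
        exact smul_ne_zero ht0 (hx0 _) h1.symm
      · have h1 := hupt l hl t
        rw [h0, map_zero, eq_comm, smul_eq_zero] at h1
        rw [(hleft l (by omega)).2 (h1.resolve_right ih), smul_zero, add_zero] at h0
        exact hx0 l h0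
  refine ⟨hne, fun l => ?_, fun l => ?_, ?_, fun l hl => ?_, fun l => ?_⟩
  · rw [Submodule.map_span, Set.image_singleton, Submodule.span_singleton_le_iff_mem,
      Submodule.mem_span_singleton]
    rcases eq_or_ne l i with rfl | hl
    · exact ⟨t, by rw [hupi, hright (l + 1) (by omega), smul_zero, add_zero]⟩
    · exact ⟨c l, (hupt l hl t).symm⟩
  · rw [Submodule.map_span, Set.image_singleton, Submodule.span_singleton_le_iff_mem,
      Submodule.mem_span_singleton]
    exact ⟨d l, by rw [hdownt, hd, smul_add, smul_comm, hcd, smul_zero, add_zero]⟩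
  · rw [hupi]
    exact smul_ne_zero ht0 (hx0 _)
  · rw [hupt l hl, hc, smul_eq_zero, smul_eq_zero, or_iff_left (hne _), or_iff_left (hx0 _)]
  · rw [hdownt]

end ZChain
end

section
/- Let 𝔳 be a pure special chain over a field k and H ⊆ ℤ a subset which is a support or a cosupport of 𝔳. If 𝔴 = (W_i) and 𝔴' = (W'_i) are pure dimension-1 subrepresentations of 𝔳 with W_j = W'_j for every j ∈ H, then W_i = W'_i for every i ∈ ℤ. -/
open LinearMap Submodule Module

namespace ZChain

universe u v

variable {k : Type u} [Field k]

variable {V : ℤ → Type v} [∀ i, AddCommGroup (V i)] [∀ i, Module k (V i)]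

theorem castMap_mem {W : ∀ i : ℤ, Submodule k (V i)} {i j : ℤ} (h : i = j) {x : V i}
    (hx : x ∈ W i) : castMap (k := k) h x ∈ W j := by
  subst h
  exact hx

theorem IsSubrep.upPow_mem {up : ∀ i : ℤ, V i →ₗ[k] V (i + 1)}
    {down : ∀ i : ℤ, V (i + 1) →ₗ[k] V i} {W : ∀ i : ℤ, Submodule k (V i)}
    (hW : IsSubrep up down W) (n : ℕ) (i : ℤ) {x : V i} (hx : x ∈ W i) :
    upPow up n i x ∈ W (i + n) := by
  induction n with
  | zero => exact castMap_mem _ hx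
  | succ n ih => exact castMap_mem _ ((hW _).1 _ ih)

theorem IsSubrep.downPow_mem {up : ∀ i : ℤ, V i →ₗ[k] V (i + 1)}
    {down : ∀ i : ℤ, V (i + 1) →ₗ[k] V i} {W : ∀ i : ℤ, Submodule k (V i)}
    (hW : IsSubrep up down W) (n : ℕ) (i : ℤ) {x : V (i + n)} (hx : x ∈ W (i + n)) :
    downPow down n i x ∈ W i := by
  induction n with
  | zero => exact castMap_mem _ hx
  | succ n ih => exact ih ((hW _).2 _ (castMap_mem _ hx))

theorem IsSubrep.map_transfer_le {up : ∀ i : ℤ, V i →ₗ[k] V (i + 1)}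
    {down : ∀ i : ℤ, V (i + 1) →ₗ[k] V i} {W : ∀ i : ℤ, Submodule k (V i)}
    (hW : IsSubrep up down W) (i j : ℤ) :
    (W i).map (transfer up down i j) ≤ W j := by
  rintro _ ⟨x, hx, rfl⟩
  unfold transfer
  split_ifs with h
  · exact castMap_mem _ (hW.upPow_mem _ _ hx)
  · exact hW.downPow_mem _ _ (castMap_mem _ hx)

/-- An injective transfer map between members of equal finite dimension is onto. -/
theorem IsSubrep.map_transfer_eq {up : ∀ i : ℤ, V i →ₗ[k] V (i + 1)}
    {down : ∀ i : ℤ, V (i + 1) →ₗ[k] V i} {W : ∀ i : ℤ, Submodule k (V i)}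
    (hW : IsSubrep up down W) {i j : ℤ} [FiniteDimensional k (V j)]
    (hdim : finrank k (W i) = finrank k (W j))
    (hinj : Function.Injective (transfer up down i j)) :
    (W i).map (transfer up down i j) = W j :=
  Submodule.eq_of_le_of_finrank_eq (hW.map_transfer_le i j)
    ((LinearEquiv.finrank_eq (Submodule.equivMapOfInjective _ hinj (W i))).symm.trans hdim)

/-- Two pure dimension-1 subrepresentations of a pure special chain that
agree on a support or a cosupport `H` agree everywhere. -/
theorem subrep_ext_on_support_or_cosupport
    (V : ℤ → Type v) [∀ i, AddCommGroup (V i)] [∀ i, Module k (V i)]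
    [∀ i, FiniteDimensional k (V i)]
    (up : ∀ i : ℤ, V i →ₗ[k] V (i + 1)) (down : ∀ i : ℤ, V (i + 1) →ₗ[k] V i)
    (hsc : SpecialChain up down)
    (r : ℕ) (hpure : ∀ i : ℤ, Module.finrank k (V i) = r)
    (H : Set ℤ) (hH : RepSupport up down H ∨ RepCosupport up down H)
    (W W' : ∀ i : ℤ, Submodule k (V i))
    (hW : IsSubrep up down W) (hW1 : ∀ i : ℤ, Module.finrank k (W i) = 1)
    (hW' : IsSubrep up down W') (hW'1 : ∀ i : ℤ, Module.finrank k (W' i) = 1)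
    (hagree : ∀ j ∈ H, W j = W' j) :
    ∀ i : ℤ, W i = W' i := by
  have dim (i j : ℤ) : finrank k (W i) = finrank k (W j) := (hW1 i).trans (hW1 j).symm
  have dim' (i j : ℤ) : finrank k (W' i) = finrank k (W' j) := (hW'1 i).trans (hW'1 j).symm
  intro i
  rcases hH with hH | hH
  · obtain ⟨j, hj, hsurj⟩ := hH i
    have hinj : Function.Injective (transfer up down j i) :=
      (LinearMap.injective_iff_surjective_of_finrank_eq_finrank
        ((hpure j).trans (hpure i).symm)).2 hsurj
    rw [← hW.map_transfer_eq (dim j i) hinj, ← hW'.map_transfer_eq (dim' j i) hinj,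
      hagree j hj]
  · obtain ⟨j, hj, hinj⟩ := hH i
    apply Submodule.map_injective_of_injective hinj
    rw [hW.map_transfer_eq (dim i j) hinj, hW'.map_transfer_eq (dim' i j) hinj, hagree j hj]

end ZChain
end

section
/- Let 𝔳 be a representation of the ℤ-quiver over a field k, let 𝔴 = (W_i ⊆ V_i) be a subrepresentation equipped with the induced maps, and let H ⊆ ℤ. Then: (i) if H is a cosupport of 𝔳, then H is a cosupport of 𝔴; (ii) if 𝔳 is a special chain, so is 𝔴; (iii) if 𝔳 is a linked chain, so is 𝔴; (iv) if 𝔳 and 𝔴 are both pure and H is a support of 𝔳, then H is a support of 𝔴. -/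
open LinearMap Submodule Module

namespace ZChain

universe u v

variable {k : Type u} [Field k]

variable {V : ℤ → Type v} [∀ i, AddCommGroup (V i)] [∀ i, Module k (V i)]

section Restrict

variable {W : ∀ i : ℤ, Submodule k (V i)}

theorem coe_castMap {i j : ℤ} (h : i = j) (x : W i) :
    ((castMap (V := fun i => ↥(W i)) (k := k) h x : W j) : V j) =
      castMap (k := k) h (x : V i) := by
  subst h; rfl

theorem coe_upPow_restrict (up : ∀ i : ℤ, V i →ₗ[k] V (i + 1))
    (hW : ∀ i, ∀ x ∈ W i, up i x ∈ W (i + 1)) (n : ℕ) (i : ℤ) (x : W i) :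
    ((upPow (V := fun i => ↥(W i)) (fun i => (up i).restrict (hW i)) n i x : W (i + n)) :
      V (i + n)) = upPow up n i x := by
  induction n with
  | zero => exact coe_castMap _ x
  | succ n ih =>
    simp only [upPow, LinearMap.comp_apply, coe_castMap, LinearMap.coe_restrict_apply, ih]

theorem coe_downPow_restrict (down : ∀ i : ℤ, V (i + 1) →ₗ[k] V i)
    (hW : ∀ i, ∀ x ∈ W (i + 1), down i x ∈ W i) (n : ℕ) (i : ℤ) (x : W (i + n)) :
    ((downPow (V := fun i => ↥(W i)) (fun i => (down i).restrict (hW i)) n i x : W i) :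
      V i) = downPow down n i x := by
  induction n with
  | zero => exact coe_castMap _ x
  | succ n ih =>
    simp only [downPow, LinearMap.comp_apply, coe_castMap, LinearMap.coe_restrict_apply, ih]

theorem coe_transfer_restrict {up : ∀ i : ℤ, V i →ₗ[k] V (i + 1)}
    {down : ∀ i : ℤ, V (i + 1) →ₗ[k] V i} (hW : IsSubrep up down W) (i j : ℤ) (x : W i) :
    ((transfer (V := fun i => ↥(W i)) (fun i => (up i).restrict (hW i).1)
      (fun i => (down i).restrict (hW i).2) i j x : W j) : V j) = transfer up down i j x := by
  unfold transfer
  split_ifs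
  · simp only [LinearMap.comp_apply, coe_castMap,
      coe_upPow_restrict up (fun i => (hW i).1)]
  · simp only [LinearMap.comp_apply, coe_castMap,
      coe_downPow_restrict down (fun i => (hW i).2)]

theorem transfer_restrict_injective {up : ∀ i : ℤ, V i →ₗ[k] V (i + 1)}
    {down : ∀ i : ℤ, V (i + 1) →ₗ[k] V i} (hW : IsSubrep up down W) {i j : ℤ}
    (h : Function.Injective (transfer up down i j)) :
    Function.Injective (transfer (V := fun i => ↥(W i)) (fun i => (up i).restrict (hW i).1)
      (fun i => (down i).restrict (hW i).2) i j) := fun x y hxy => by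
  apply Subtype.ext
  apply h
  rw [← coe_transfer_restrict hW, ← coe_transfer_restrict hW, hxy]

theorem SpecialChain.restrict {up : ∀ i : ℤ, V i →ₗ[k] V (i + 1)}
    {down : ∀ i : ℤ, V (i + 1) →ₗ[k] V i} (hW : IsSubrep up down W)
    (h : SpecialChain up down) :
    SpecialChain (V := fun i => ↥(W i))
      (fun i => (up i).restrict (hW i).1) (fun i => (down i).restrict (hW i).2) := fun i =>
  ⟨LinearMap.ext fun x => Subtype.ext (LinearMap.congr_fun (h i).1 (x : V i)),
    LinearMap.ext fun x => Subtype.ext (LinearMap.congr_fun (h i).2 (x : V (i + 1)))⟩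

end Restrict

/-- Let `𝔴 = (W i)` be a subrepresentation of `𝔳`, equipped with the
induced maps. (i) If `H` is a cosupport of `𝔳` then it is a cosupport of `𝔴`; (ii) if `𝔳` is
a special chain so is `𝔴`; (iii) if `𝔳` is a linked chain so is `𝔴`; (iv) if `𝔳` and `𝔴`
are pure and `H` is a support of `𝔳`, then `H` is a support of `𝔴`. -/
theorem subrep_inherits
    (V : ℤ → Type v) [∀ i, AddCommGroup (V i)] [∀ i, Module k (V i)]
    [∀ i, FiniteDimensional k (V i)]
    (up : ∀ i : ℤ, V i →ₗ[k] V (i + 1)) (down : ∀ i : ℤ, V (i + 1) →ₗ[k] V i)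
    (W : ∀ i : ℤ, Submodule k (V i)) (hW : IsSubrep up down W) (H : Set ℤ) :
    (RepCosupport up down H →
      RepCosupport (V := fun i => ↥(W i))
        (fun i => (up i).restrict (hW i).1) (fun i => (down i).restrict (hW i).2) H) ∧
    (SpecialChain up down →
      SpecialChain (V := fun i => ↥(W i))
        (fun i => (up i).restrict (hW i).1) (fun i => (down i).restrict (hW i).2)) ∧
    (LinkedChain up down →
      LinkedChain (V := fun i => ↥(W i))
        (fun i => (up i).restrict (hW i).1) (fun i => (down i).restrict (hW i).2)) ∧
    ((∃ r : ℕ, ∀ i : ℤ, Module.finrank k (V i) = r) →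
      (∃ r : ℕ, ∀ i : ℤ, Module.finrank k (W i) = r) →
      RepSupport up down H →
      RepSupport (V := fun i => ↥(W i))
        (fun i => (up i).restrict (hW i).1) (fun i => (down i).restrict (hW i).2) H) := by
  refine ⟨fun h i => ?_, fun h => h.restrict hW, fun h => ⟨h.1.restrict hW, fun i => ?_⟩, ?_⟩
  · obtain ⟨j, hj, hinj⟩ := h i
    exact ⟨j, hj, transfer_restrict_injective hW hinj⟩
  · rw [eq_bot_iff]
    rintro x ⟨hd, hu⟩
    have hx : (x : V (i + 1)) ∈ ker (down i) ⊓ ker (up (i + 1)) :=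
      ⟨congrArg Subtype.val hd, congrArg Subtype.val hu⟩
    rw [h.2 i] at hx
    exact Subtype.ext hx
  · rintro ⟨r, hr⟩ ⟨s, hs⟩ h i
    obtain ⟨j, hj, hsurj⟩ := h i
    have hinj := (LinearMap.injective_iff_surjective_of_finrank_eq_finrank
      ((hr j).trans (hr i).symm)).2 hsurj
    exact ⟨j, hj, (LinearMap.injective_iff_surjective_of_finrank_eq_finrank
      ((hs j).trans (hs i).symm)).1 (transfer_restrict_injective hW hinj)⟩

end ZChain
end

section
/- A nontrivial special chain over a field k cannot have both finite support and finite cosupport; that is, if 𝔳 is a special chain with V_i ≠ 0 for every i ∈ ℤ, then it is not the case that some finite subset of ℤ is a support of 𝔳 and some finite subset of ℤ is a cosupport of 𝔳. -/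
open LinearMap Submodule Module

namespace ZChain

universe u v

variable {k : Type u} [Field k]

variable {V : ℤ → Type v} [∀ i, AddCommGroup (V i)] [∀ i, Module k (V i)]

theorem castMap_self {V : ℤ → Type v} [∀ i, AddCommGroup (V i)] [∀ i, Module k (V i)]
    {i : ℤ} (h : i = i) (x : V i) : castMap (k := k) h x = x := rfl

theorem castMap_castMap {V : ℤ → Type v} [∀ i, AddCommGroup (V i)] [∀ i, Module k (V i)]
    {i j l : ℤ} (h : i = j) (h' : j = l) (x : V i) :
    castMap (k := k) h' (castMap (k := k) h x) = castMap (k := k) (h.trans h') x := by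
  subst h h'
  rfl

/-- A transfer map ending at `m + 1` and starting at or below `m` factors through `v^m`. -/
theorem range_transfer_succ_le (up : ∀ i : ℤ, V i →ₗ[k] V (i + 1))
    (down : ∀ i : ℤ, V (i + 1) →ₗ[k] V i) {h m : ℤ} (hm : h ≤ m) :
    range (transfer up down h (m + 1)) ≤ range (up m) := by
  obtain ⟨n, rfl⟩ := Int.le.dest hm
  have key : ∀ (N : ℕ) (p : h + N = h + n + 1), N = n + 1 →
      range (castMap p ∘ₗ upPow up N h) ≤ range (up (h + n)) := by
    rintro N p rfl _ ⟨x, rfl⟩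
    exact ⟨upPow up n h x, by simp [upPow, castMap_castMap, castMap_self]⟩
  rw [transfer, dif_pos (by omega)]
  exact key _ _ (by omega)

/-- A transfer map starting at `m + 1` and ending at or below `m` factors through `v_m`. -/
theorem ker_le_ker_transfer_succ (up : ∀ i : ℤ, V i →ₗ[k] V (i + 1))
    (down : ∀ i : ℤ, V (i + 1) →ₗ[k] V i) {j m : ℤ} (hm : j ≤ m) :
    ker (down m) ≤ ker (transfer up down (m + 1) j) := by
  obtain ⟨n, rfl⟩ := Int.le.dest hm
  have key : ∀ (N : ℕ) (p : j + n + 1 = j + N), N = n + 1 →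
      ker (down (j + n)) ≤ ker (downPow down N j ∘ₗ castMap p) := by
    rintro N p rfl x hx
    simp_all [downPow, castMap_castMap, castMap_self]
  rw [transfer, dif_neg (by omega)]
  exact key _ _ (by omega)

/-- A nontrivial special chain cannot have both finite support and finite
cosupport. -/
theorem not_finite_support_and_cosupport
    (V : ℤ → Type v) [∀ i, AddCommGroup (V i)] [∀ i, Module k (V i)]
    [∀ i, FiniteDimensional k (V i)]
    (up : ∀ i : ℤ, V i →ₗ[k] V (i + 1)) (down : ∀ i : ℤ, V (i + 1) →ₗ[k] V i)
    (hsc : SpecialChain up down) (hnt : ∀ i : ℤ, Nontrivial (V i)) :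
    ¬ ((∃ H : Finset ℤ, RepSupport up down ↑H) ∧
       (∃ H : Finset ℤ, RepCosupport up down ↑H)) := by
  rintro ⟨⟨H, hH⟩, ⟨H', hH'⟩⟩
  obtain ⟨m, hm⟩ := (H ∪ H').bddAbove
  obtain ⟨h, hh, hsurj⟩ := hH (m + 1)
  obtain ⟨j, hj, hinj⟩ := hH' (m + 1)
  have hup := range_transfer_succ_le up down (hm (Finset.mem_union_left H' hh))
  have hdown := ker_le_ker_transfer_succ up down (hm (Finset.mem_union_right H hj))
  rw [range_eq_top.mpr hsurj] at hup
  rw [ker_eq_bot.mpr hinj] at hdown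
  obtain ⟨x, hx⟩ := exists_ne (0 : V (m + 1))
  obtain ⟨y, rfl⟩ := hup (mem_top (x := x))
  exact hx (hdown (LinearMap.congr_fun (hsc m).1 y))

end ZChain
end
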